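/- For every q ∈ Q̂, the interval [0̂, q] = {p ∈ Q̂ : p ≤ q} admits an EL-labeling: there exist a totally ordered set Λ and an edge labeling λ of [0̂, q] with values in Λ such that every interval of [0̂, q] contains a unique increasing maximal chain, and this chain is lexicographically minimal among all maximal chains of that interval. -/

import Mathlib

/-!
Common definitions: Bruhat order, standard parabolic subgroups, minimal coset
representatives, the J-Bruhat (twisted) order and J-length, chains and
EL-labeling machinery, for a Coxeter system `cs : CoxeterSystem M W`.
-/

open scoped Classical

namespace TwistedTP

/-- A chain (list) realizing consecutive `r`-steps starting at `a` and ending at `b`. -/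
def IsChainFrom {α : Type*} (r : α → α → Prop) (c : List α) (a b : α) : Prop :=
  c.head? = some a ∧ c.getLast? = some b ∧ c.Chain' r

/-- The word of labels attached to the consecutive pairs of a list.
For a list `z₀ :: z₁ :: ⋯` (written from top to bottom in a descending chain),
the entries are `lab z₁ z₀, lab z₂ z₁, …`, i.e. `lab` is applied to each
covering pair `(lower, upper)`. -/
def labelWord {α Λ : Type*} (lab : α → α → Λ) : List α → List Λ
  | a :: b :: rest => lab b a :: labelWord lab (b :: rest)
  | _ => []

variable {B : Type} {W : Type} [Group W] {M : CoxeterMatrix B}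
variable (cs : CoxeterSystem M W)

/-- The (strong) Bruhat order on `W`: `v ≤ w` iff some reduced word for `w`
has a sublist whose product is `v`. -/
def bruhatLE (v w : W) : Prop :=
  ∃ ω : List B, cs.IsReduced ω ∧ cs.wordProd ω = w ∧
    ∃ ω' : List B, ω'.Sublist ω ∧ cs.wordProd ω' = v

def bruhatLT (v w : W) : Prop := bruhatLE cs v w ∧ v ≠ w

def bruhatCovBy (v w : W) : Prop :=
  bruhatLT cs v w ∧ ¬ ∃ z, bruhatLT cs v z ∧ bruhatLT cs z w

/-- The standard parabolic subgroup `W_J`. -/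
def parabolic (J : Set B) : Subgroup W := Subgroup.closure (cs.simple '' J)

lemma exists_minRep (J : Set B) (w : W) :
    ∃ u : W, u⁻¹ * w ∈ parabolic cs J ∧
      ∀ x : W, x⁻¹ * w ∈ parabolic cs J → cs.length u ≤ cs.length x := by
  have hne : (cs.length '' {x : W | x⁻¹ * w ∈ parabolic cs J}).Nonempty :=
    ⟨cs.length w, w, by simpa using (parabolic cs J).one_mem, rfl⟩
  obtain ⟨n, hn, hmin⟩ := Nat.lt_wfRel.wf.has_min _ hne
  obtain ⟨u, hu, rfl⟩ := hn
  refine ⟨u, hu, fun x hx => ?_⟩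
  by_contra h
  exact hmin _ ⟨x, hx, rfl⟩ (Nat.lt_of_not_le h)

/-- The minimal-length representative `w^J` of the coset `w W_J`. -/
noncomputable def minRep (J : Set B) (w : W) : W := (exists_minRep cs J w).choose

/-- The parabolic part `w_J = (w^J)⁻¹ w ∈ W_J` of `w`. -/
noncomputable def parPart (J : Set B) (w : W) : W := (minRep cs J w)⁻¹ * w

/-- The J-Bruhat (twisted) order `≤^J` on `W`:
`v ≤^J w` iff there is `u ∈ W_J` with `v^J u ≤ w^J` and `w_J ≤ u⁻¹ v_J`. -/
def twistedLE (J : Set B) (v w : W) : Prop :=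
  ∃ u ∈ parabolic cs J,
    bruhatLE cs (minRep cs J v * u) (minRep cs J w) ∧
    bruhatLE cs (parPart cs J w) (u⁻¹ * parPart cs J v)

def twistedLT (J : Set B) (v w : W) : Prop := twistedLE cs J v w ∧ v ≠ w

def twistedCovBy (J : Set B) (v w : W) : Prop :=
  twistedLT cs J v w ∧ ¬ ∃ z, twistedLT cs J v z ∧ twistedLT cs J z w

/-- The J-length `ℓ^J(w) = ℓ(w^J) - ℓ(w_J)` (an integer). -/
noncomputable def twistedLength (J : Set B) (w : W) : ℤ :=
  (cs.length (minRep cs J w) : ℤ) - (cs.length (parPart cs J w) : ℤ)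



/-- `lab` is an EL-labeling for the poset with order `le` and covering relation `cov`,
with labels in `(Λ, lt)`: every interval `[x, y]` contains a unique increasing maximal
chain (chains are written descending, from `y` to `x`, as in the definition of the
label word), and that chain is lexicographically minimal among all maximal chains
of the interval. -/
def IsELOn {α Λ : Type*} (le cov : α → α → Prop) (lt : Λ → Λ → Prop)
    (lab : α → α → Λ) : Prop :=
  ∀ x y : α, le x y →
    ∃ c : List α,
      (IsChainFrom (fun a b => cov b a) c y x ∧ List.Chain' lt (labelWord lab c)) ∧
      (∀ c' : List α, IsChainFrom (fun a b => cov b a) c' y x ∧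
          List.Chain' lt (labelWord lab c') → c' = c) ∧
      (∀ c' : List α, IsChainFrom (fun a b => cov b a) c' y x →
        List.Lex lt (labelWord lab c) (labelWord lab c') ∨
          labelWord lab c = labelWord lab c')

/-- Membership in `Q`: triples `(w, v, u)` such that `w ∘_l v ≤ u`, i.e. there is
`w' ≤ w` with `w' v ≤ u`. -/
def Qmem (t : W × W × W) : Prop :=
  ∃ w' : W, bruhatLE cs w' t.1 ∧ bruhatLE cs (w' * t.2.1) t.2.2

/-- The order on `Q`: `(w',v',u') ≤_Q (w,v,u)` iff `w' ≤ w`, `v ≤ v'` and `u' ≤ u`. -/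
def qqle (a b : W × W × W) : Prop :=
  bruhatLE cs a.1 b.1 ∧ bruhatLE cs b.2.1 a.2.1 ∧ bruhatLE cs a.2.2 b.2.2

def qqlt (a b : W × W × W) : Prop := qqle cs a b ∧ a ≠ b

/-- Membership in the augmented poset `Q̂ = Q ⊔ {0̂}`; `none` is the adjoined minimum. -/
def hvalid : Option (W × W × W) → Prop
  | none => True
  | some t => Qmem cs t

/-- The order of `Q̂`. -/
def hle : Option (W × W × W) → Option (W × W × W) → Prop
  | none, _ => True
  | some _, none => False
  | some a, some b => qqle cs a b

def hlt (p q : Option (W × W × W)) : Prop := hle cs p q ∧ p ≠ q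

/-- The covering relation of the poset `Q̂` (among its members). -/
def hcov (p q : Option (W × W × W)) : Prop :=
  hvalid cs p ∧ hvalid cs q ∧ hlt cs p q ∧
    ¬∃ z : Option (W × W × W), hvalid cs z ∧ hlt cs p z ∧ hlt cs z q

/-! ### The geometric representation, extended by one weight vector -/

/-- The space spanned by the simple roots `α i = single i 1` and a vector `single ⊥ 1`
pairing to `1` with each simple root. -/
abbrev GeomSpace (B : Type) := WithBot B →₀ ℝ

/-- The Gram matrix of the invariant form on `GeomSpace B`. -/
noncomputable def gram (M : CoxeterMatrix B) : WithBot B → WithBot B → ℝ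
  | some i, some j => -2 * Real.cos (Real.pi / M i j)
  | none, none => 0
  | _, _ => 1

/-- The invariant symmetric bilinear form on `GeomSpace B`. -/
noncomputable def gform (M : CoxeterMatrix B) :
    GeomSpace B →ₗ[ℝ] GeomSpace B →ₗ[ℝ] ℝ :=
  Finsupp.linearCombination ℝ (fun i => Finsupp.linearCombination ℝ (gram M i))

/-- The simple root `α i`. -/
noncomputable def simpleRoot (i : B) : GeomSpace B := Finsupp.single (i : WithBot B) 1

/-- The vector pairing to `1` with each simple root. -/
noncomputable def weightVec (B : Type) : GeomSpace B := Finsupp.single ⊥ 1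

lemma gram_coe (M : CoxeterMatrix B) (i j : B) :
    gram M (i : WithBot B) (j : WithBot B) = - (2 * Real.cos (Real.pi / M i j)) := by
  rw [← neg_mul]; rfl

lemma gram_bot (M : CoxeterMatrix B) (i : B) : gram M (i : WithBot B) ⊥ = 1 := rfl

lemma gram_comm (M : CoxeterMatrix B) (i j : WithBot B) : gram M i j = gram M j i := by
  induction i using WithBot.recBotCoe <;> induction j using WithBot.recBotCoe
  · rfl
  · rfl
  · rfl
  · rw [gram_coe, gram_coe, M.symmetric]

lemma gform_single (M : CoxeterMatrix B) (i j : WithBot B) (a b : ℝ) :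
    gform M (Finsupp.single i a) (Finsupp.single j b) = a * b * gram M i j := by
  simp [gform, mul_assoc]

lemma gform_comm (M : CoxeterMatrix B) (x y : GeomSpace B) : gform M x y = gform M y x := by
  have : gform M = (gform M).flip := by
    ext i j
    have := gform_single M i j 1 1
    have := gform_single M j i 1 1
    simp_all [gram_comm M i j]
  conv_lhs => rw [this]
  rfl

lemma gform_simpleRoot_self (i : B) : gform M (simpleRoot i) (simpleRoot i) = 2 := by
  rw [simpleRoot, gform_single, gram_coe]; simp

lemma gform_simpleRoot (i j : B) :
    gform M (simpleRoot i) (simpleRoot j) = - (2 * Real.cos (Real.pi / M i j)) := by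
  rw [simpleRoot, simpleRoot, gform_single, gram_coe]; simp

/-- The reflection in the simple root `α i`. -/
noncomputable def simpleRefl (M : CoxeterMatrix B) (i : B) : GeomSpace B →ₗ[ℝ] GeomSpace B :=
  LinearMap.id - (gform M (simpleRoot i)).smulRight (simpleRoot i)

lemma simpleRefl_apply (i : B) (z : GeomSpace B) :
    simpleRefl M i z = z - gform M (simpleRoot i) z • simpleRoot i := by
  simp [simpleRefl]

lemma simpleRefl_self (i : B) :
    simpleRefl M i (simpleRoot i) = - simpleRoot i := by
  rw [simpleRefl_apply, gform_simpleRoot_self]; module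

lemma simpleRefl_mul_self (i : B) : simpleRefl M i * simpleRefl M i = 1 := by
  apply LinearMap.ext
  intro z
  rw [Module.End.mul_apply, simpleRefl_apply i z, map_sub, map_smul, simpleRefl_self, simpleRefl_apply]
  simp

lemma simpleRefl_other (i j : B) :
    simpleRefl M i (simpleRoot j) =
      simpleRoot j + (2 * Real.cos (Real.pi / M i j)) • simpleRoot i := by
  rw [simpleRefl_apply, gform_simpleRoot]; module

/-- Chebyshev-type coefficients: `chebCoeff s k = sin (k θ) / sin θ` when `s = 2 cos θ`. -/
def chebCoeff (s : ℝ) : ℕ → ℝ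
  | 0 => 0
  | 1 => 1
  | k + 2 => s * chebCoeff s (k + 1) - chebCoeff s k

lemma chebCoeff_two : ∀ k : ℕ, chebCoeff 2 k = k
  | 0 => by simp [chebCoeff]
  | 1 => by simp [chebCoeff]
  | k + 2 => by
    rw [chebCoeff, chebCoeff_two k, chebCoeff_two (k + 1)]; push_cast; ring

lemma chebCoeff_mul_sin (θ : ℝ) :
    ∀ k : ℕ, chebCoeff (2 * Real.cos θ) k * Real.sin θ = Real.sin (k * θ)
  | 0 => by simp [chebCoeff]
  | 1 => by simp [chebCoeff]
  | k + 2 => by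
    have h1 := chebCoeff_mul_sin θ k
    have h2 := chebCoeff_mul_sin θ (k + 1)
    have e2 : ((k + 2 : ℕ) : ℝ) * θ = ((k + 1 : ℕ) : ℝ) * θ + θ := by push_cast; ring
    have e0 : (k : ℝ) * θ = ((k + 1 : ℕ) : ℝ) * θ - θ := by push_cast; ring
    rw [chebCoeff, sub_mul, mul_assoc, h2, h1, e2, e0, Real.sin_add, Real.sin_sub]
    ring

lemma sin_pi_div_pos {m : ℕ} (hm : 2 ≤ m) : 0 < Real.sin (Real.pi / m) := by
  have h2 : (2 : ℝ) ≤ m := by exact_mod_cast hm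
  apply Real.sin_pos_of_pos_of_lt_pi
  · have := Real.pi_pos; positivity
  · rw [div_lt_iff₀ (by linarith)]
    nlinarith [Real.pi_pos]

lemma two_le_of_ne {i j : B} (hij : i ≠ j) (hm : M i j ≠ 0) : 2 ≤ M i j := by
  have := M.off_diagonal i j hij
  omega

lemma chebCoeff_nonneg {i j : B} (hij : i ≠ j) {k : ℕ} (hk : M i j = 0 ∨ k ≤ M i j) :
    0 ≤ chebCoeff (2 * Real.cos (Real.pi / M i j)) k := by
  by_cases h0 : M i j = 0
  · rw [h0]
    simp [chebCoeff_two]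
  · have h2 := two_le_of_ne hij h0
    have hk := hk.resolve_left h0
    have hs := sin_pi_div_pos h2
    have := chebCoeff_mul_sin (Real.pi / M i j) k
    have hpos : 0 ≤ Real.sin (k * (Real.pi / M i j)) := by
      have hm : (0 : ℝ) < M i j := by exact_mod_cast (by omega : 0 < M i j)
      have hk' : (k : ℝ) ≤ M i j := by exact_mod_cast hk
      apply Real.sin_nonneg_of_nonneg_of_le_pi
      · have := Real.pi_pos; positivity
      · rw [mul_div_assoc', div_le_iff₀ hm]
        nlinarith [Real.pi_pos]
    rw [← this] at hpos
    exact nonneg_of_mul_nonneg_left hpos hs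

lemma simpleRefl_mul_pow_apply (i j : B) (k : ℕ) :
    ((simpleRefl M i * simpleRefl M j) ^ k) (simpleRoot i) =
      chebCoeff (2 * Real.cos (Real.pi / M i j)) (2 * k + 1) • simpleRoot i +
      chebCoeff (2 * Real.cos (Real.pi / M i j)) (2 * k) • simpleRoot j := by
  induction k with
  | zero => simp [chebCoeff]
  | succ k ih =>
    rw [pow_succ', Module.End.mul_apply, ih, Module.End.mul_apply]
    simp only [map_add, map_smul, simpleRefl_self, simpleRefl_other, map_neg]
    rw [show 2 * (k + 1) + 1 = (2 * k + 1) + 2 by ring, show 2 * (k + 1) = 2 * k + 2 by ring,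
      chebCoeff, chebCoeff, M.symmetric j i]
    module

lemma simpleRefl_mul_pow_root (i j : B) :
    ((simpleRefl M i * simpleRefl M j) ^ M i j) (simpleRoot i) = simpleRoot i := by
  by_cases hij : i = j
  · subst hij; simp [simpleRefl_mul_self]
  by_cases h0 : M i j = 0
  · rw [h0]; simp
  have hs := sin_pi_div_pos (two_le_of_ne hij h0)
  have hm : (M i j : ℝ) ≠ 0 := by exact_mod_cast h0
  have h1 := chebCoeff_mul_sin (Real.pi / M i j) (2 * M i j)
  have h2 := chebCoeff_mul_sin (Real.pi / M i j) (2 * M i j + 1)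
  have e1 : ((2 * M i j : ℕ) : ℝ) * (Real.pi / M i j) = 2 * Real.pi := by
    push_cast; field_simp
  have e2 : ((2 * M i j + 1 : ℕ) : ℝ) * (Real.pi / M i j) = Real.pi / M i j + 2 * Real.pi := by
    push_cast; field_simp; ring
  rw [e1, Real.sin_two_pi] at h1
  rw [e2, Real.sin_add_two_pi] at h2
  have h1' := (mul_eq_zero.mp h1).resolve_right hs.ne'
  have h2' : chebCoeff (2 * Real.cos (Real.pi / M i j)) (2 * M i j + 1) = 1 :=
    mul_right_cancel₀ hs.ne' (by rw [h2, one_mul])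
  rw [simpleRefl_mul_pow_apply, h1', h2']
  simp

lemma simpleRefl_mul_pow_root' (i j : B) :
    ((simpleRefl M i * simpleRefl M j) ^ M i j) (simpleRoot j) = simpleRoot j := by
  have hinv : (simpleRefl M i * simpleRefl M j) * (simpleRefl M j * simpleRefl M i) = 1 := by
    rw [mul_assoc, ← mul_assoc (simpleRefl M j), simpleRefl_mul_self, one_mul,
      simpleRefl_mul_self]
  have hinv' : (simpleRefl M j * simpleRefl M i) * (simpleRefl M i * simpleRefl M j) = 1 := by
    rw [mul_assoc, ← mul_assoc (simpleRefl M i), simpleRefl_mul_self, one_mul,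
      simpleRefl_mul_self]
  have hc : Commute (simpleRefl M i * simpleRefl M j) (simpleRefl M j * simpleRefl M i) := by
    rw [Commute, SemiconjBy, hinv, hinv']
  have h := simpleRefl_mul_pow_root (M := M) j i
  conv_lhs => rw [← h]
  rw [← Module.End.mul_apply, M.symmetric j i, ← hc.mul_pow, hinv]
  simp

lemma simpleRefl_isLiftable : M.IsLiftable (simpleRefl M) := by
  intro i j
  by_cases hij : i = j
  · subst hij; simp [simpleRefl_mul_self]
  by_cases h0 : M i j = 0
  · rw [h0]; simp
  have hs := sin_pi_div_pos (two_le_of_ne hij h0)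
  set c := Real.cos (Real.pi / M i j) with hc
  have hdet : 1 - c ^ 2 ≠ 0 := by
    have := Real.sin_sq (Real.pi / M i j)
    rw [← hc] at this
    rw [← this]; positivity
  apply LinearMap.ext
  intro z
  set p := gform M (simpleRoot i) z
  set q := gform M (simpleRoot j) z
  set a := (p + c * q) / (2 * (1 - c ^ 2)) with ha
  set b := (q + c * p) / (2 * (1 - c ^ 2)) with hb
  set z' := z - a • simpleRoot i - b • simpleRoot j with hz'
  have hi : gform M (simpleRoot i) z' = 0 := by
    rw [hz']
    simp only [map_sub, map_smul, gform_simpleRoot_self, gform_simpleRoot, smul_eq_mul]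
    rw [← hc, ha, hb]; field_simp; ring
  have hj : gform M (simpleRoot j) z' = 0 := by
    rw [hz']
    simp only [map_sub, map_smul, gform_simpleRoot_self, gform_simpleRoot, smul_eq_mul]
    rw [M.symmetric j i, ← hc, ha, hb]; field_simp; ring
  have hfix : ∀ k : ℕ, ((simpleRefl M i * simpleRefl M j) ^ k) z' = z' := by
    intro k
    induction k with
    | zero => simp
    | succ k ih =>
      rw [pow_succ', Module.End.mul_apply, ih, Module.End.mul_apply, simpleRefl_apply j, hj]
      simp [simpleRefl_apply, hi]
  have hz : z = z' + a • simpleRoot i + b • simpleRoot j := by rw [hz']; module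
  rw [hz, map_add, map_add, hfix, map_smul, map_smul, simpleRefl_mul_pow_root,
    simpleRefl_mul_pow_root']
  rfl

/-- The geometric representation of `W`. -/
noncomputable def geomRep : W →* (GeomSpace B →ₗ[ℝ] GeomSpace B) :=
  cs.lift ⟨simpleRefl M, simpleRefl_isLiftable⟩

lemma geomRep_simple (i : B) : geomRep cs (cs.simple i) = simpleRefl M i :=
  cs.lift_apply_simple simpleRefl_isLiftable i

lemma geomRep_mul (x y : W) (z : GeomSpace B) :
    geomRep cs (x * y) z = geomRep cs x (geomRep cs y z) := by
  rw [map_mul, Module.End.mul_apply]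

lemma geomRep_one (z : GeomSpace B) : geomRep cs 1 z = z := by
  rw [map_one]; rfl

lemma geomRep_apply_inv (x : W) (z : GeomSpace B) :
    geomRep cs x (geomRep cs x⁻¹ z) = z := by
  rw [← geomRep_mul, mul_inv_cancel, geomRep_one]

lemma gform_simpleRefl (i : B) (y z : GeomSpace B) :
    gform M (simpleRefl M i y) (simpleRefl M i z) = gform M y z := by
  simp only [simpleRefl_apply, map_sub, map_smul, LinearMap.sub_apply, LinearMap.smul_apply,
    gform_simpleRoot_self, smul_eq_mul, gform_comm M y (simpleRoot i)]
  ring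

lemma gform_geomRep (w : W) (y z : GeomSpace B) :
    gform M (geomRep cs w y) (geomRep cs w z) = gform M y z := by
  induction w using cs.simple_induction generalizing y z with
  | simple i => rw [geomRep_simple, gform_simpleRefl]
  | one => simp
  | mul w w' h h' => rw [geomRep_mul, geomRep_mul, h, h']

/-! ### Positive roots -/

lemma simpleRefl_apply_of_ne (i : B) (z : GeomSpace B) {k : WithBot B} (hk : k ≠ i) :
    simpleRefl M i z k = z k := by
  rw [simpleRefl_apply, Finsupp.sub_apply, Finsupp.smul_apply, simpleRoot,
    Finsupp.single_eq_of_ne hk]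
  simp

lemma geomRep_apply_bot (w : W) (z : GeomSpace B) : geomRep cs w z ⊥ = z ⊥ := by
  induction w using cs.simple_induction generalizing z with
  | simple i => rw [geomRep_simple, simpleRefl_apply_of_ne _ _ (by simp)]
  | one => rw [geomRep_one]
  | mul w w' h h' => rw [geomRep_mul, h, h']

lemma simpleRoot_nonneg (i : B) : 0 ≤ simpleRoot i := by
  rw [simpleRoot]; exact Finsupp.single_nonneg.mpr zero_le_one

lemma geomRep_alternatingWord_apply (i j : B) (k : ℕ) :
    geomRep cs (cs.wordProd (CoxeterSystem.alternatingWord i j k)) (simpleRoot i) =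
      if Even k then
        chebCoeff (2 * Real.cos (Real.pi / M i j)) (k + 1) • simpleRoot i +
          chebCoeff (2 * Real.cos (Real.pi / M i j)) k • simpleRoot j
      else
        chebCoeff (2 * Real.cos (Real.pi / M i j)) k • simpleRoot i +
          chebCoeff (2 * Real.cos (Real.pi / M i j)) (k + 1) • simpleRoot j := by
  induction k with
  | zero => simp [CoxeterSystem.alternatingWord, chebCoeff]
  | succ k ih =>
    rw [CoxeterSystem.alternatingWord_succ', cs.wordProd_cons, geomRep_mul, ih]
    by_cases hk : Even k
    · rw [if_pos hk, if_pos hk, if_neg (by simpa [Nat.even_add_one] using hk), geomRep_simple]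
      simp only [map_add, map_smul, simpleRefl_self, simpleRefl_other, chebCoeff,
        M.symmetric j i]
      module
    · rw [if_neg hk, if_neg hk, if_pos (by simpa [Nat.even_add_one] using hk), geomRep_simple]
      simp only [map_add, map_smul, simpleRefl_self, simpleRefl_other, chebCoeff]
      module

lemma exists_maximal_alternating (w : W) {i j : B}
    (hj : cs.length (w * cs.simple j) < cs.length w) :
    ∃ (v : W) (k : ℕ), 1 ≤ k ∧ w = v * cs.wordProd (CoxeterSystem.alternatingWord i j k) ∧
      cs.length v + k = cs.length w ∧
      cs.length v < cs.length (v * cs.simple i) ∧ cs.length v < cs.length (v * cs.simple j) := by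
  let P : ℕ → Prop := fun k => ∃ v : W,
    w = v * cs.wordProd (CoxeterSystem.alternatingWord i j k) ∧ cs.length v + k = cs.length w
  have h1 : P 1 := by
    refine ⟨w * cs.simple j, ?_, ?_⟩
    · simp [CoxeterSystem.alternatingWord, mul_assoc]
    · rcases cs.length_mul_simple w j with h | h <;> omega
  have hb : ∀ k, P k → k ≤ cs.length w := fun k ⟨v, _, h⟩ => by omega
  have hk1 : 1 ≤ Nat.findGreatest P (cs.length w) := Nat.le_findGreatest (hb 1 h1) h1
  have hPk : P (Nat.findGreatest P (cs.length w)) := Nat.findGreatest_spec (hb 1 h1) h1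
  obtain ⟨k, hk⟩ : ∃ k, Nat.findGreatest P (cs.length w) = k + 1 := ⟨_, (Nat.succ_pred_eq_of_pos hk1).symm⟩
  have hmax : ¬ P (k + 2) := fun h => by
    have := Nat.le_findGreatest (hb _ h) h
    omega
  rw [hk] at hPk
  obtain ⟨v, hw, hl⟩ := hPk
  have hup : cs.length v < cs.length (v * cs.simple (if Even (k + 1) then j else i)) := by
    rcases cs.length_mul_simple v (if Even (k + 1) then j else i) with h | h
    · omega
    · exfalso
      refine hmax ⟨v * cs.simple (if Even (k + 1) then j else i), ?_, by omega⟩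
      rw [CoxeterSystem.alternatingWord_succ' _ _ (k + 1), cs.wordProd_cons, mul_assoc,
        cs.simple_mul_simple_cancel_left]
      exact hw
  have hdn : cs.length v < cs.length (v * cs.simple (if Even k then j else i)) := by
    rcases cs.length_mul_simple v (if Even k then j else i) with h | h
    · omega
    · exfalso
      rw [CoxeterSystem.alternatingWord_succ' _ _ k, cs.wordProd_cons, ← mul_assoc] at hw
      have h2 := cs.length_mul_le (v * cs.simple (if Even k then j else i))
        (cs.wordProd (CoxeterSystem.alternatingWord i j k))
      have h3 := cs.length_wordProd_le (CoxeterSystem.alternatingWord i j k)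
      rw [CoxeterSystem.length_alternatingWord] at h3
      rw [← hw] at h2
      omega
  refine ⟨v, k + 1, by omega, hw, hl, ?_, ?_⟩
  · by_cases he : Even k
    · rwa [if_neg (by simpa [Nat.even_add_one] using he)] at hup
    · rwa [if_neg he] at hdn
  · by_cases he : Even k
    · rwa [if_pos he] at hdn
    · rwa [if_pos (by simpa [Nat.even_add_one] using he)] at hup

lemma geomRep_simpleRoot_nonneg (w : W) (i : B)
    (hi : cs.length w < cs.length (w * cs.simple i)) : 0 ≤ geomRep cs w (simpleRoot i) := by
  induction hn : cs.length w using Nat.strong_induction_on generalizing w i with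
  | _ n ih =>
    subst hn
    by_cases hw : w = 1
    · rw [hw, geomRep_one]; exact simpleRoot_nonneg i
    obtain ⟨j, hj⟩ := cs.exists_rightDescent_of_ne_one hw
    have hij : i ≠ j := by
      rintro rfl
      exact absurd hj (not_lt.mpr hi.le)
    obtain ⟨v, k, hk, hwv, hl, hvi, hvj⟩ := exists_maximal_alternating cs w (i := i) hj
    have hI := ih _ (by omega) v i hvi rfl
    have hJ := ih _ (by omega) v j hvj rfl
    have hM : M i j = 0 ∨ k + 1 ≤ M i j := by
      by_contra! hM
      refine cs.not_isReduced_alternatingWord j i (m := k + 1) (by rw [M.symmetric]; exact hM.1)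
        (by rw [M.symmetric]; exact hM.2) ?_
      rw [CoxeterSystem.IsReduced]
      apply le_antisymm (cs.length_wordProd_le _)
      rw [CoxeterSystem.length_alternatingWord]
      have h2 := cs.length_mul_le v
        (cs.wordProd (CoxeterSystem.alternatingWord j i (k + 1)))
      rw [CoxeterSystem.alternatingWord_succ, cs.wordProd_concat, ← mul_assoc, ← hwv] at h2
      rw [CoxeterSystem.alternatingWord_succ, cs.wordProd_concat]
      omega
    have c1 := chebCoeff_nonneg hij hM
    have c0 := chebCoeff_nonneg hij (k := k) (hM.imp id (by omega))
    rw [hwv, geomRep_mul, geomRep_alternatingWord_apply]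
    split_ifs
    · rw [map_add, map_smul, map_smul]
      exact add_nonneg (smul_nonneg c1 hI) (smul_nonneg c0 hJ)
    · rw [map_add, map_smul, map_smul]
      exact add_nonneg (smul_nonneg c0 hI) (smul_nonneg c1 hJ)

lemma simpleRoot_apply_self (i : B) : simpleRoot i (i : WithBot B) = 1 := by
  simp [simpleRoot]

lemma geomRep_simple_simpleRoot (i : B) :
    geomRep cs (cs.simple i) (simpleRoot i) = - simpleRoot i := by
  rw [geomRep_simple, simpleRefl_self]

lemma geomRep_injective : Function.Injective (geomRep cs) := by
  rw [injective_iff_map_eq_one]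
  intro w hw
  by_contra h1
  obtain ⟨i, hi⟩ := cs.exists_rightDescent_of_ne_one h1
  have h := geomRep_simpleRoot_nonneg cs (w * cs.simple i) i
    (by rw [cs.simple_mul_simple_cancel_right]; exact hi)
  rw [geomRep_mul, geomRep_simple_simpleRoot, hw, Module.End.one_apply] at h
  have := h (i : WithBot B)
  rw [Finsupp.neg_apply, simpleRoot_apply_self, Finsupp.zero_apply] at this
  linarith

/-- A root: an element of the orbit of a simple root. -/
def IsRoot (β : GeomSpace B) : Prop := ∃ (w : W) (i : B), β = geomRep cs w (simpleRoot i)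

variable {cs}

lemma IsRoot.neg {β : GeomSpace B} (h : IsRoot cs β) : IsRoot cs (-β) := by
  obtain ⟨w, i, rfl⟩ := h
  exact ⟨w * cs.simple i, i, by rw [geomRep_mul, geomRep_simple_simpleRoot, map_neg]⟩

lemma IsRoot.geomRep {β : GeomSpace B} (h : IsRoot cs β) (w : W) :
    IsRoot cs (geomRep cs w β) := by
  obtain ⟨v, i, rfl⟩ := h
  exact ⟨w * v, i, by rw [geomRep_mul]⟩

lemma IsRoot.gform_self {β : GeomSpace B} (h : IsRoot cs β) : gform M β β = 2 := by
  obtain ⟨v, i, rfl⟩ := h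
  rw [gform_geomRep, gform_simpleRoot_self]

lemma IsRoot.ne_zero {β : GeomSpace B} (h : IsRoot cs β) : β ≠ 0 := by
  rintro rfl
  simpa using h.gform_self

lemma IsRoot.apply_bot {β : GeomSpace B} (h : IsRoot cs β) : β ⊥ = 0 := by
  obtain ⟨v, i, rfl⟩ := h
  rw [geomRep_apply_bot, simpleRoot, Finsupp.single_eq_of_ne (by simp)]

lemma IsRoot.nonneg_or {β : GeomSpace B} (h : IsRoot cs β) : 0 ≤ β ∨ 0 ≤ -β := by
  obtain ⟨v, i, rfl⟩ := h
  rcases cs.length_mul_simple v i with h | h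
  · left; exact geomRep_simpleRoot_nonneg cs v i (by omega)
  · right
    have := geomRep_simpleRoot_nonneg cs (v * cs.simple i) i
      (by rw [cs.simple_mul_simple_cancel_right]; omega)
    rwa [geomRep_mul, geomRep_simple_simpleRoot, map_neg] at this

lemma IsRoot.not_nonneg_iff {β : GeomSpace B} (h : IsRoot cs β) : ¬ 0 ≤ β ↔ 0 ≤ -β := by
  constructor
  · exact h.nonneg_or.resolve_left
  · intro h1 h2
    exact h.ne_zero (le_antisymm (by simpa using h1) h2)

lemma exists_posRoot {t : W} (ht : cs.IsReflection t) :
    ∃ β, IsRoot cs β ∧ 0 ≤ β ∧ ∀ z, TwistedTP.geomRep cs t z = z - gform M β z • β := by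
  obtain ⟨w, i, rfl⟩ := ht
  have key : ∀ z, TwistedTP.geomRep cs (w * cs.simple i * w⁻¹) z =
      z - gform M (TwistedTP.geomRep cs w (simpleRoot i)) z •
        TwistedTP.geomRep cs w (simpleRoot i) := by
    intro z
    rw [geomRep_mul, geomRep_mul, geomRep_simple, simpleRefl_apply, map_sub, map_smul,
      geomRep_apply_inv, ← gform_geomRep cs w (simpleRoot i), geomRep_apply_inv]
  have hr : IsRoot cs (TwistedTP.geomRep cs w (simpleRoot i)) := ⟨w, i, rfl⟩
  rcases hr.nonneg_or with h | h
  · exact ⟨_, hr, h, key⟩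
  · refine ⟨_, hr.neg, h, fun z => ?_⟩
    rw [key, map_neg, LinearMap.neg_apply]
    module

lemma IsRoot.unique {t : W} {β γ : GeomSpace B} (hβ : IsRoot cs β) (hγ : IsRoot cs γ)
    (h0 : 0 ≤ β) (h1 : 0 ≤ γ) (h : ∀ z, TwistedTP.geomRep cs t z = z - gform M β z • β)
    (h' : ∀ z, TwistedTP.geomRep cs t z = z - gform M γ z • γ) : β = γ := by
  have e := (h β).symm.trans (h' β)
  rw [hβ.gform_self] at e
  have e2 : β = (gform M γ β / 2) • γ := by
    have : (2 : ℝ) • β = gform M γ β • γ := by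
      have := congrArg (fun x => β - x) e
      simpa using this
    rw [div_eq_inv_mul, mul_smul, ← this, smul_smul]; simp
  set c := gform M γ β / 2 with hc
  have e3 := hβ.gform_self
  rw [e2, map_smul, map_smul, LinearMap.smul_apply, hγ.gform_self] at e3
  simp only [smul_eq_mul] at e3
  have h4 : (c - 1) * (c + 1) = 0 := by linarith
  rcases mul_eq_zero.mp h4 with h5 | h5
  · rw [e2, show c = 1 by linarith, one_smul]
  · exfalso
    rw [show c = -1 by linarith, neg_one_smul] at e2
    rw [e2] at h0
    exact hγ.not_nonneg_iff.mpr h0 h1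

variable (cs)

/-- The positive root attached to a reflection. -/
noncomputable def posRoot (t : W) : GeomSpace B :=
  if ht : cs.IsReflection t then (exists_posRoot ht).choose else 0

variable {cs}

lemma posRoot_spec {t : W} (ht : cs.IsReflection t) : IsRoot cs (posRoot cs t) ∧
    0 ≤ posRoot cs t ∧
      ∀ z, geomRep cs t z = z - gform M (posRoot cs t) z • posRoot cs t := by
  rw [posRoot, dif_pos ht]
  exact (exists_posRoot ht).choose_spec

lemma posRoot_eq {t : W} (ht : cs.IsReflection t) {β : GeomSpace B} (hβ : IsRoot cs β)
    (h0 : 0 ≤ β) (h : ∀ z, geomRep cs t z = z - gform M β z • β) : posRoot cs t = β :=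
  (posRoot_spec ht).1.unique hβ (posRoot_spec ht).2.1 h0 (posRoot_spec ht).2.2 h

lemma posRoot_simple (i : B) : posRoot cs (cs.simple i) = simpleRoot i :=
  posRoot_eq (cs.isReflection_simple i) ⟨1, i, (geomRep_one cs _).symm⟩ (simpleRoot_nonneg i)
    (fun z => by rw [geomRep_simple, simpleRefl_apply])

lemma posRoot_injective {r t : W} (hr : cs.IsReflection r) (ht : cs.IsReflection t)
    (h : posRoot cs r = posRoot cs t) : r = t := by
  apply geomRep_injective cs
  apply LinearMap.ext
  intro z
  rw [(posRoot_spec hr).2.2, (posRoot_spec ht).2.2, h]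

lemma geomRep_conj_apply {t : W} (ht : cs.IsReflection t) (w : W) (z : GeomSpace B) :
    geomRep cs (w * t * w⁻¹) z =
      z - gform M (geomRep cs w (posRoot cs t)) z • geomRep cs w (posRoot cs t) := by
  rw [geomRep_mul, geomRep_mul, (posRoot_spec ht).2.2, map_sub, map_smul,
    geomRep_apply_inv, ← gform_geomRep cs w (posRoot cs t), geomRep_apply_inv]

lemma isRoot_geomRep_posRoot {t : W} (ht : cs.IsReflection t) (w : W) :
    IsRoot cs (geomRep cs w (posRoot cs t)) := (posRoot_spec ht).1.geomRep w

lemma posRoot_conj_of_nonneg {t : W} (ht : cs.IsReflection t) (w : W)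
    (h : 0 ≤ geomRep cs w (posRoot cs t)) :
    posRoot cs (w * t * w⁻¹) = geomRep cs w (posRoot cs t) :=
  posRoot_eq (ht.conj w) (isRoot_geomRep_posRoot ht w) h (geomRep_conj_apply ht w)

lemma posRoot_conj_of_not_nonneg {t : W} (ht : cs.IsReflection t) (w : W)
    (h : ¬ 0 ≤ geomRep cs w (posRoot cs t)) :
    posRoot cs (w * t * w⁻¹) = - geomRep cs w (posRoot cs t) :=
  posRoot_eq (ht.conj w) (isRoot_geomRep_posRoot ht w).neg
    ((isRoot_geomRep_posRoot ht w).not_nonneg_iff.mp h) (fun z => by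
      rw [geomRep_conj_apply ht w, map_neg, LinearMap.neg_apply]; module)

lemma eq_simpleRoot_of_not_nonneg {γ : GeomSpace B} (hγ : IsRoot cs γ) (h0 : 0 ≤ γ) {i : B}
    (h : ¬ 0 ≤ geomRep cs (cs.simple i) γ) : γ = simpleRoot i := by
  have hn := (hγ.geomRep (cs.simple i)).not_nonneg_iff.mp h
  have hk : ∀ k : WithBot B, k ≠ i → γ k = 0 := by
    intro k hk
    have h1 := hn k
    rw [geomRep_simple, Finsupp.neg_apply, simpleRefl_apply_of_ne _ _ hk] at h1
    have h2 := h0 k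
    simp only [Finsupp.coe_zero, Pi.zero_apply] at h1 h2
    linarith
  have e : γ = γ i • simpleRoot i := by
    ext k
    rw [Finsupp.smul_apply, simpleRoot]
    by_cases hki : k = i
    · subst hki; simp
    · rw [hk k hki, Finsupp.single_eq_of_ne hki]; simp
  have h2 := hγ.gform_self
  have hc : 0 ≤ γ i := h0 i
  set c := γ i
  rw [e, map_smul, map_smul, LinearMap.smul_apply, gform_simpleRoot_self] at h2
  simp only [smul_eq_mul] at h2
  have : c = 1 := by nlinarith
  rw [e, this, one_smul]

lemma length_wordProd_mul_lt {t : W} (ht : cs.IsReflection t) (ω : List B)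
    (h : ¬ 0 ≤ geomRep cs (cs.wordProd ω) (posRoot cs t)) :
    cs.length (cs.wordProd ω * t) < ω.length := by
  induction ω with
  | nil =>
    rw [cs.wordProd_nil, geomRep_one] at h
    exact absurd (posRoot_spec ht).2.1 h
  | cons i ω ih =>
    rw [cs.wordProd_cons, List.length_cons]
    by_cases h' : 0 ≤ geomRep cs (cs.wordProd ω) (posRoot cs t)
    · have hpr := posRoot_conj_of_nonneg ht _ h'
      rw [cs.wordProd_cons, geomRep_mul] at h
      have e := eq_simpleRoot_of_not_nonneg (isRoot_geomRep_posRoot ht _) h' h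
      rw [e, ← posRoot_simple (cs := cs)] at hpr
      have e2 := posRoot_injective (ht.conj _) (cs.isReflection_simple i) hpr
      rw [← e2]
      have : cs.wordProd ω * t * (cs.wordProd ω)⁻¹ * cs.wordProd ω * t = cs.wordProd ω := by
        rw [inv_mul_cancel_right, mul_assoc, ht.mul_self, mul_one]
      rw [this]
      exact Nat.lt_succ_of_le (cs.length_wordProd_le ω)
    · have := ih h'
      have h2 := cs.length_mul_le (cs.simple i) (cs.wordProd ω * t)
      rw [cs.length_simple, ← mul_assoc] at h2
      omega

/-- A reflection shortens `w` exactly when `w` makes its positive root negative. -/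
lemma length_mul_lt_iff {t : W} (ht : cs.IsReflection t) (w : W) :
    cs.length (w * t) < cs.length w ↔ ¬ 0 ≤ geomRep cs w (posRoot cs t) := by
  have key : ∀ x : W, ¬ 0 ≤ geomRep cs x (posRoot cs t) → cs.length (x * t) < cs.length x := by
    intro x hx
    obtain ⟨ω, hω, rfl⟩ := cs.exists_isReduced x
    have := length_wordProd_mul_lt ht ω hx
    rwa [hω.eq]
  refine ⟨fun h h0 => ?_, key w⟩
  have e : geomRep cs (w * t) (posRoot cs t) = - geomRep cs w (posRoot cs t) := by
    rw [geomRep_mul, (posRoot_spec ht).2.2, (posRoot_spec ht).1.gform_self, ← map_neg]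
    congr 1
    module
  have h1 := key (w * t) (by
    rw [e, (isRoot_geomRep_posRoot ht w).neg.not_nonneg_iff, neg_neg]
    exact h0)
  rw [mul_assoc, ht.mul_self, mul_one] at h1
  omega

lemma length_lt_mul_iff {t : W} (ht : cs.IsReflection t) (w : W) :
    cs.length w < cs.length (w * t) ↔ 0 ≤ geomRep cs w (posRoot cs t) := by
  have h := length_mul_lt_iff ht w
  have := ht.length_mul_left_ne w
  rw [← not_iff_not, ← h]
  omega

/-! ### Lifting properties of lengths -/

lemma length_inv_mul (w t : W) (ht : cs.IsReflection t) :
    cs.length (w⁻¹ * t) = cs.length (t * w) := by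
  rw [← cs.length_inv, mul_inv_rev, inv_inv, ht.inv]

lemma length_mul_left_lt_iff {t : W} (ht : cs.IsReflection t) (w : W) :
    cs.length (t * w) < cs.length w ↔ ¬ 0 ≤ geomRep cs w⁻¹ (posRoot cs t) := by
  rw [← length_mul_lt_iff ht, length_inv_mul _ _ ht, cs.length_inv]

lemma length_lt_mul_left_iff {t : W} (ht : cs.IsReflection t) (w : W) :
    cs.length w < cs.length (t * w) ↔ 0 ≤ geomRep cs w⁻¹ (posRoot cs t) := by
  rw [← length_lt_mul_iff ht, length_inv_mul _ _ ht, cs.length_inv]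

/-- Conjugating a simple reflection. -/
lemma isReflection_conj_simple (x : W) (i : B) : cs.IsReflection (x⁻¹ * cs.simple i * x) := by
  simpa using (cs.isReflection_simple i).conj x⁻¹

lemma length_lt_mul_iff_simple {t x : W} (ht : cs.IsReflection t) (i : B)
    (hne : t ≠ x⁻¹ * cs.simple i * x) :
    cs.length x < cs.length (x * t) ↔
      cs.length (cs.simple i * x) < cs.length (cs.simple i * x * t) := by
  have key : ∀ y : W, t ≠ y⁻¹ * cs.simple i * y → cs.length y < cs.length (y * t) →
      cs.length (cs.simple i * y) < cs.length (cs.simple i * y * t) := by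
    intro y hy h
    rw [length_lt_mul_iff ht] at h ⊢
    by_contra hc
    rw [geomRep_mul] at hc
    have e := eq_simpleRoot_of_not_nonneg (isRoot_geomRep_posRoot ht y) h hc
    rw [← posRoot_conj_of_nonneg ht y h, ← posRoot_simple (cs := cs)] at e
    have e2 := posRoot_injective (ht.conj y) (cs.isReflection_simple i) e
    apply hy
    rw [← e2]; group
  refine ⟨key x hne, fun h => ?_⟩
  have := key (cs.simple i * x) (by simpa [mul_assoc] using hne) h
  simpa [← mul_assoc] using this

lemma posRoot_conj_simple_of_lt {x : W} {i : B}
    (h : cs.length x < cs.length (cs.simple i * x)) :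
    posRoot cs (x⁻¹ * cs.simple i * x) = geomRep cs x⁻¹ (simpleRoot i) := by
  rw [length_lt_mul_left_iff (cs.isReflection_simple i)] at h
  have := posRoot_conj_of_nonneg (cs.isReflection_simple i) _ h
  rwa [inv_inv, posRoot_simple] at this

lemma posRoot_conj_simple_of_gt {x : W} {i : B}
    (h : cs.length (cs.simple i * x) < cs.length x) :
    posRoot cs (x⁻¹ * cs.simple i * x) = - geomRep cs x⁻¹ (simpleRoot i) := by
  rw [length_mul_left_lt_iff (cs.isReflection_simple i)] at h
  have := posRoot_conj_of_not_nonneg (cs.isReflection_simple i) _ h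
  rwa [inv_inv, posRoot_simple] at this

lemma length_conj_mul_lt_iff_of_gt {x : W} {i : B} (b : W)
    (h : cs.length (cs.simple i * x) < cs.length x) :
    cs.length (x⁻¹ * cs.simple i * x * b) < cs.length b ↔
      cs.length (x * b) < cs.length (cs.simple i * x * b) := by
  rw [length_mul_left_lt_iff (isReflection_conj_simple x i), posRoot_conj_simple_of_gt h,
    mul_assoc, length_lt_mul_left_iff (cs.isReflection_simple i), posRoot_simple,
    mul_inv_rev, geomRep_mul, map_neg]
  have hr : IsRoot cs (geomRep cs b⁻¹ (geomRep cs x⁻¹ (simpleRoot i))) :=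
    (IsRoot.geomRep ⟨x⁻¹, i, rfl⟩ _)
  rw [hr.neg.not_nonneg_iff, neg_neg]

lemma length_conj_mul_lt_iff_of_lt {x : W} {i : B} (b : W)
    (h : cs.length x < cs.length (cs.simple i * x)) :
    cs.length (x⁻¹ * cs.simple i * x * b) < cs.length b ↔
      cs.length (cs.simple i * x * b) < cs.length (x * b) := by
  rw [length_mul_left_lt_iff (isReflection_conj_simple x i), posRoot_conj_simple_of_lt h,
    mul_assoc, length_mul_left_lt_iff (cs.isReflection_simple i), posRoot_simple,
    mul_inv_rev, geomRep_mul]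

/-! ### Reflection orders -/

/-- The height functional: pairing with the weight vector. -/
noncomputable def hgt (M : CoxeterMatrix B) : GeomSpace B →ₗ[ℝ] ℝ :=
  (gform M).flip (weightVec B)

lemma hgt_apply (z : GeomSpace B) : hgt M z = gform M z (weightVec B) := rfl

lemma gform_single_weightVec (k : WithBot B) (a : ℝ) :
    gform M (Finsupp.single k a) (weightVec B) = a * gram M k ⊥ := by
  rw [weightVec, gform_single, mul_one]

lemma hgt_eq_sum (z : GeomSpace B) : hgt M z = ∑ k ∈ z.support, z k * gram M k ⊥ := by
  conv_lhs => rw [← Finsupp.sum_single z]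
  rw [Finsupp.sum, map_sum]
  refine Finset.sum_congr rfl fun k _ => ?_
  rw [hgt_apply, gform_single_weightVec]

lemma IsRoot.hgt_pos {β : GeomSpace B} (h : IsRoot cs β) (h0 : 0 ≤ β) : 0 < hgt M β := by
  have hk : ∀ k ∈ β.support, 0 < β k * gram M k ⊥ := by
    intro k hk
    have hk' := Finsupp.mem_support_iff.mp hk
    induction k using WithBot.recBotCoe with
    | bot => exact absurd h.apply_bot hk'
    | coe i =>
      rw [gram_bot, mul_one]
      exact lt_of_le_of_ne (h0 i) (Ne.symm hk')
  rw [hgt_eq_sum]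
  exact Finset.sum_pos hk (Finsupp.support_nonempty_iff.mpr h.ne_zero)

lemma IsRoot.hgt_pos_iff {β : GeomSpace B} (h : IsRoot cs β) : 0 < hgt M β ↔ 0 ≤ β := by
  refine ⟨fun h1 => ?_, h.hgt_pos⟩
  by_contra h2
  have := h.neg.hgt_pos (h.not_nonneg_iff.mp h2)
  rw [map_neg] at this
  linarith

lemma IsRoot.hgt_neg_iff {β : GeomSpace B} (h : IsRoot cs β) : hgt M β < 0 ↔ ¬ 0 ≤ β := by
  rw [h.not_nonneg_iff, ← h.neg.hgt_pos_iff, map_neg, neg_pos]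

variable (cs)

/-- The map recording the height of `b⁻¹ z` in the bottom coordinate. -/
noncomputable def twistBot (b : W) : GeomSpace B →ₗ[ℝ] GeomSpace B :=
  LinearMap.id -
    (Finsupp.lapply ⊥ + (hgt M).comp (geomRep cs b⁻¹)).smulRight (Finsupp.single ⊥ 1)

/-- The normalized vector representing the reflection `t` in the order attached to `b`. -/
noncomputable def keyVec (b t : W) : GeomSpace B :=
  (hgt M (posRoot cs t))⁻¹ • twistBot cs b (posRoot cs t)

variable {cs}

lemma twistBot_apply_bot (b : W) (z : GeomSpace B) :
    twistBot cs b z ⊥ = - hgt M (geomRep cs b⁻¹ z) := by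
  simp [twistBot]

lemma twistBot_apply_of_ne (b : W) (z : GeomSpace B) {k : WithBot B} (hk : k ≠ ⊥) :
    twistBot cs b z k = z k := by
  simp [twistBot, Finsupp.single_eq_of_ne hk]

lemma hgt_posRoot_pos {t : W} (ht : cs.IsReflection t) : 0 < hgt M (posRoot cs t) :=
  (posRoot_spec ht).1.hgt_pos (posRoot_spec ht).2.1

lemma smul_keyVec {t : W} (ht : cs.IsReflection t) (b : W) :
    hgt M (posRoot cs t) • keyVec cs b t = twistBot cs b (posRoot cs t) := by
  rw [keyVec, smul_smul, mul_inv_cancel₀ (hgt_posRoot_pos ht).ne', one_smul]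

lemma keyVec_injective {r t : W} (hr : cs.IsReflection r) (ht : cs.IsReflection t) (b : W)
    (h : keyVec cs b r = keyVec cs b t) : r = t := by
  apply posRoot_injective hr ht
  set p := hgt M (posRoot cs r)
  set q := hgt M (posRoot cs t)
  have hp : 0 < p := hgt_posRoot_pos hr
  have hq : 0 < q := hgt_posRoot_pos ht
  have hc : posRoot cs r = (p * q⁻¹) • posRoot cs t := by
    ext k
    rcases eq_or_ne k ⊥ with rfl | hk
    · rw [Finsupp.smul_apply, (posRoot_spec hr).1.apply_bot, (posRoot_spec ht).1.apply_bot,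
        smul_zero]
    · have h1 := congrArg (fun f => f k) (smul_keyVec hr b)
      have h2 := congrArg (fun f => f k) (smul_keyVec ht b)
      simp only [Finsupp.smul_apply, twistBot_apply_of_ne _ _ hk, smul_eq_mul] at h1 h2 ⊢
      rw [← h1, ← h2, h]
      field_simp
      simp only [p, q]
      ring
  have h3 := (posRoot_spec hr).1.gform_self
  have hpos : 0 < p * q⁻¹ := by positivity
  set c := p * q⁻¹
  rw [hc, map_smul, map_smul, LinearMap.smul_apply, (posRoot_spec ht).1.gform_self] at h3
  simp only [smul_eq_mul] at h3
  have : c = 1 := by nlinarith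
  rw [hc, this, one_smul]

lemma keyVec_conj_of_nonneg {r t : W} (hr : cs.IsReflection r) (ht : cs.IsReflection t) (b : W)
    (h : 0 ≤ geomRep cs t (posRoot cs r)) :
    hgt M (posRoot cs (t * r * t)) • (keyVec cs b t - keyVec cs b (t * r * t)) =
      hgt M (posRoot cs r) • (keyVec cs b t - keyVec cs b r) := by
  have hu : cs.IsReflection (t * r * t) := by simpa [ht.inv] using hr.conj t
  have e : posRoot cs (t * r * t) =
      posRoot cs r - gform M (posRoot cs t) (posRoot cs r) • posRoot cs t := by
    have := posRoot_conj_of_nonneg hr t h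
    rwa [ht.inv, (posRoot_spec ht).2.2] at this
  rw [smul_sub, smul_sub, smul_keyVec hu, smul_keyVec hr]
  rw [e, map_sub, map_sub, map_smul, map_smul, ← smul_keyVec ht, smul_eq_mul]
  module

lemma keyVec_conj_of_not_nonneg {r t : W} (hr : cs.IsReflection r) (ht : cs.IsReflection t)
    (b : W) (h : ¬ 0 ≤ geomRep cs t (posRoot cs r)) :
    hgt M (posRoot cs (t * r * t)) • (keyVec cs b (t * r * t) - keyVec cs b t) =
      hgt M (posRoot cs r) • (keyVec cs b t - keyVec cs b r) := by
  have hu : cs.IsReflection (t * r * t) := by simpa [ht.inv] using hr.conj t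
  have e : posRoot cs (t * r * t) =
      - (posRoot cs r - gform M (posRoot cs t) (posRoot cs r) • posRoot cs t) := by
    have := posRoot_conj_of_not_nonneg hr t h
    rwa [ht.inv, (posRoot_spec ht).2.2] at this
  rw [smul_sub, smul_sub, smul_keyVec hu, smul_keyVec hr]
  rw [e, map_neg, map_neg, map_sub, map_sub, map_smul, map_smul, ← smul_keyVec ht, smul_eq_mul]
  module

lemma geomRep_inv_weightVec {t : W} (ht : cs.IsReflection t) (y : W) :
    geomRep cs (y * t)⁻¹ (weightVec B) = geomRep cs y⁻¹ (weightVec B) -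
      hgt M (geomRep cs y (posRoot cs t)) • posRoot cs t := by
  rw [mul_inv_rev, ht.inv, geomRep_mul, (posRoot_spec ht).2.2, hgt_apply,
    ← gform_geomRep cs y (posRoot cs t), geomRep_apply_inv]

section Keys

variable [LinearOrder B]

/-- Positivity for the lexicographic order on coordinates. -/
def LexPos (x : GeomSpace B) : Prop := 0 < toLex x

lemma lexPos_iff {x : GeomSpace B} : LexPos x ↔ ∃ k, (∀ d < k, x d = 0) ∧ 0 < x k := by
  rw [LexPos, Finsupp.Lex.lt_iff]
  simp [eq_comm]

lemma LexPos.add {x y : GeomSpace B} (hx : LexPos x) (hy : LexPos y) : LexPos (x + y) := by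
  rw [LexPos, toLex_add]
  exact add_pos hx hy

lemma LexPos.smul {x : GeomSpace B} (hx : LexPos x) {c : ℝ} (hc : 0 < c) : LexPos (c • x) := by
  rw [lexPos_iff] at hx ⊢
  obtain ⟨k, h1, h2⟩ := hx
  refine ⟨k, fun d hd => ?_, ?_⟩
  · rw [Finsupp.smul_apply, h1 d hd, smul_zero]
  · rw [Finsupp.smul_apply, smul_eq_mul]; positivity

lemma lexPos_smul_iff {x : GeomSpace B} {c : ℝ} (hc : 0 < c) : LexPos (c • x) ↔ LexPos x := by
  refine ⟨fun h => ?_, fun h => h.smul hc⟩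
  have := h.smul (inv_pos.mpr hc)
  rwa [smul_smul, inv_mul_cancel₀ hc.ne', one_smul] at this

lemma lexPos_iff_bot {x : GeomSpace B} (h : x ⊥ ≠ 0) : LexPos x ↔ 0 < x ⊥ := by
  rw [lexPos_iff]
  constructor
  · rintro ⟨k, h1, h2⟩
    rcases eq_or_ne k ⊥ with rfl | hk
    · exact h2
    · exact absurd (h1 ⊥ (bot_lt_iff_ne_bot.mpr hk)) h
  · exact fun h2 => ⟨⊥, by simp, h2⟩

lemma toLex_lt_iff (x y : GeomSpace B) : toLex x < toLex y ↔ LexPos (y - x) := by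
  rw [LexPos, toLex_sub, sub_pos]

lemma keyVec_lexPos_iff {t : W} (ht : cs.IsReflection t) (b : W) :
    LexPos (keyVec cs b t) ↔ cs.length (t * b) < cs.length b := by
  have hr := isRoot_geomRep_posRoot ht b⁻¹
  have hne : hgt M (geomRep cs b⁻¹ (posRoot cs t)) ≠ 0 := by
    intro h
    have h1 := hr.hgt_pos_iff
    have h2 := hr.hgt_neg_iff
    rw [h] at h1 h2
    simp at h1 h2
    exact h1 h2
  rw [length_mul_left_lt_iff ht, ← hr.hgt_neg_iff, ← lexPos_smul_iff (hgt_posRoot_pos ht),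
    smul_keyVec ht, lexPos_iff_bot, twistBot_apply_bot, neg_pos]
  rw [twistBot_apply_bot]
  simpa using hne

lemma keyVec_final {r t b : W} (hr : cs.IsReflection r) (ht : cs.IsReflection t)
    (h : LexPos (keyVec cs b t - keyVec cs b r)) (hN : cs.length (r * b) < cs.length b) :
    cs.length (t * b) < cs.length b := by
  rw [← keyVec_lexPos_iff hr] at hN
  rw [← keyVec_lexPos_iff ht]
  simpa using h.add hN

lemma keyVec_rank_two {y t₁ t₂ r₁ r₂ : W} (b : W) (ht₁ : cs.IsReflection t₁)
    (ht₂ : cs.IsReflection t₂) (hr₁ : cs.IsReflection r₁) (hr₂ : cs.IsReflection r₂)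
    (he : y * t₁ * t₂ = y * r₁ * r₂)
    (hl : (cs.length (y * t₁) < cs.length y ∧ cs.length (y * t₁ * t₂) < cs.length (y * t₁) ∧
        cs.length (y * r₁) < cs.length y ∧ cs.length (y * r₁ * r₂) < cs.length (y * r₁)) ∨
      (cs.length y < cs.length (y * t₁) ∧ cs.length (y * t₁) < cs.length (y * t₁ * t₂) ∧
        cs.length y < cs.length (y * r₁) ∧ cs.length (y * r₁) < cs.length (y * r₁ * r₂)))
    (h₁ : LexPos (keyVec cs b t₁ - keyVec cs b t₂))
    (h₂ : LexPos (keyVec cs b r₂ - keyVec cs b r₁)) :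
    LexPos (keyVec cs b t₁ - keyVec cs b r₁) := by
  have e := geomRep_inv_weightVec ht₂ (y * t₁)
  rw [geomRep_inv_weightVec ht₁, he, geomRep_inv_weightVec hr₂, geomRep_inv_weightVec hr₁] at e
  rw [length_mul_lt_iff ht₁, length_mul_lt_iff ht₂, length_mul_lt_iff hr₁, length_mul_lt_iff hr₂,
    length_lt_mul_iff ht₁, length_lt_mul_iff ht₂, length_lt_mul_iff hr₁, length_lt_mul_iff hr₂,
    ← (isRoot_geomRep_posRoot ht₁ _).hgt_neg_iff, ← (isRoot_geomRep_posRoot ht₂ _).hgt_neg_iff,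
    ← (isRoot_geomRep_posRoot hr₁ _).hgt_neg_iff, ← (isRoot_geomRep_posRoot hr₂ _).hgt_neg_iff,
    ← (isRoot_geomRep_posRoot ht₁ _).hgt_pos_iff, ← (isRoot_geomRep_posRoot ht₂ _).hgt_pos_iff,
    ← (isRoot_geomRep_posRoot hr₁ _).hgt_pos_iff, ← (isRoot_geomRep_posRoot hr₂ _).hgt_pos_iff]
    at hl
  set p₁ := hgt M (geomRep cs y (posRoot cs t₁))
  set p₂ := hgt M (geomRep cs (y * t₁) (posRoot cs t₂))
  set q₁ := hgt M (geomRep cs y (posRoot cs r₁))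
  set q₂ := hgt M (geomRep cs (y * r₁) (posRoot cs r₂))
  have e' : p₁ • posRoot cs t₁ + p₂ • posRoot cs t₂ = q₁ • posRoot cs r₁ + q₂ • posRoot cs r₂ := by
    have := congrArg (fun z => geomRep cs y⁻¹ (weightVec B) - z) e
    rw [sub_sub, sub_sub, sub_sub_cancel, sub_sub_cancel] at this
    exact this.symm
  have eh := congrArg (hgt M) e'
  have el := congrArg (twistBot cs b) e'
  simp only [map_add, map_smul, smul_eq_mul, ← smul_keyVec ht₁, ← smul_keyVec ht₂,
    ← smul_keyVec hr₁, ← smul_keyVec hr₂] at eh el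
  have a₁ := hgt_posRoot_pos ht₁
  have a₂ := hgt_posRoot_pos ht₂
  have a₃ := hgt_posRoot_pos hr₁
  have a₄ := hgt_posRoot_pos hr₂
  set u₁ := hgt M (posRoot cs t₁)
  set u₂ := hgt M (posRoot cs t₂)
  set v₁ := hgt M (posRoot cs r₁)
  set v₂ := hgt M (posRoot cs r₂)
  set k₁ := keyVec cs b t₁
  set k₂ := keyVec cs b t₂
  set l₁ := keyVec cs b r₁
  set l₂ := keyVec cs b r₂
  have main : (p₁ * u₁ + p₂ * u₂) • (k₁ - l₁) =
      (p₂ * u₂) • (k₁ - k₂) + (q₂ * v₂) • (l₂ - l₁) := by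
    have x1 : (p₁ * u₁ + p₂ * u₂) • (k₁ - l₁) = (p₂ * u₂) • (k₁ - k₂) +
        (p₁ • u₁ • k₁ + p₂ • u₂ • k₂) - (p₁ * u₁ + p₂ * u₂) • l₁ := by module
    rw [x1, el, eh]
    module
  rcases hl with ⟨n₁, n₂, n₃, n₄⟩ | ⟨n₁, n₂, n₃, n₄⟩
  · have m2 : (-(p₁ * u₁ + p₂ * u₂)) • (k₁ - l₁) =
      (-(p₂ * u₂)) • (k₁ - k₂) + (-(q₂ * v₂)) • (l₂ - l₁) := by
      rw [neg_smul, main]; module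
    have c1 : 0 < -(p₁ * u₁ + p₂ * u₂) := by nlinarith
    rw [← lexPos_smul_iff c1, m2]
    exact (h₁.smul (by nlinarith)).add (h₂.smul (by nlinarith))
  · have c1 : 0 < p₁ * u₁ + p₂ * u₂ := by positivity
    rw [← lexPos_smul_iff c1, main]
    exact (h₁.smul (by positivity)).add (h₂.smul (by positivity))

end Keys

variable (cs) in
/-- A reflection order: an injective linear ordering `κ` of the reflections for which
conjugation within a rank-two reflection subgroup behaves as in betweenness of roots. -/
structure IsReflOrder {K : Type} [LinearOrder K] (κ : W → K) : Prop where
  inj : ∀ {r t : W}, cs.IsReflection r → cs.IsReflection t → κ r = κ t → r = t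
  conj_same : ∀ {x t : W} {i : B}, cs.IsReflection t → t ≠ x⁻¹ * cs.simple i * x →
    (cs.length x < cs.length (cs.simple i * x) ↔
      cs.length (x * t) < cs.length (cs.simple i * (x * t))) →
    (κ (x⁻¹ * cs.simple i * x) < κ t ↔ κ ((x * t)⁻¹ * cs.simple i * (x * t)) < κ t)
  conj_opp : ∀ {x t : W} {i : B}, cs.IsReflection t → t ≠ x⁻¹ * cs.simple i * x →
    ¬ (cs.length x < cs.length (cs.simple i * x) ↔
      cs.length (x * t) < cs.length (cs.simple i * (x * t))) →
    (κ (x⁻¹ * cs.simple i * x) < κ t ↔ κ t < κ ((x * t)⁻¹ * cs.simple i * (x * t)))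

lemma conj_mul_eq {x t : W} {i : B} (ht : cs.IsReflection t) :
    (x * t)⁻¹ * cs.simple i * (x * t) = t * (x⁻¹ * cs.simple i * x) * t := by
  rw [mul_inv_rev, ht.inv]; group

lemma conj_mul_ne {x t : W} {i : B} (ht : cs.IsReflection t)
    (h : t ≠ x⁻¹ * cs.simple i * x) : t ≠ (x * t)⁻¹ * cs.simple i * (x * t) := by
  rw [conj_mul_eq ht]
  intro h'
  apply h
  have := congrArg (fun z => t * z * t) h'
  simpa [mul_assoc, ht.mul_self, ← mul_assoc t t] using this

lemma not_lt_iff_of_ne {K : Type} [LinearOrder K] {a b : K} (h : a ≠ b) :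
    ¬ b < a ↔ a < b := by
  rw [not_lt, h.le_iff_lt]

lemma IsReflOrder.dual {K : Type} [LinearOrder K] {κ : W → K} (h : IsReflOrder cs κ) :
    IsReflOrder cs (fun t => OrderDual.toDual (κ t)) where
  inj hr ht he := h.inj hr ht he
  conj_same {x t i} ht hne hl := by
    rw [OrderDual.toDual_lt_toDual, OrderDual.toDual_lt_toDual]
    have h1 := h.conj_same ht hne hl
    have h2 : κ t ≠ κ (x⁻¹ * cs.simple i * x) :=
      fun e => hne (h.inj ht (isReflection_conj_simple _ _) e)
    have h3 : κ t ≠ κ ((x * t)⁻¹ * cs.simple i * (x * t)) :=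
      fun e => conj_mul_ne ht hne (h.inj ht (isReflection_conj_simple _ _) e)
    rw [← not_lt_iff_of_ne h2, ← not_lt_iff_of_ne h3, h1]
  conj_opp {x t i} ht hne hl := by
    rw [OrderDual.toDual_lt_toDual, OrderDual.toDual_lt_toDual]
    have h1 := h.conj_opp ht hne hl
    have h2 : κ t ≠ κ (x⁻¹ * cs.simple i * x) :=
      fun e => hne (h.inj ht (isReflection_conj_simple _ _) e)
    have h3 : κ t ≠ κ ((x * t)⁻¹ * cs.simple i * (x * t)) :=
      fun e => conj_mul_ne ht hne (h.inj ht (isReflection_conj_simple _ _) e)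
    rw [← not_lt_iff_of_ne h2, ← not_lt_iff_of_ne h3.symm, h1]

lemma geomRep_nonneg_iff {x t : W} {i : B} :
    0 ≤ geomRep cs t (posRoot cs (x⁻¹ * cs.simple i * x)) ↔
      (cs.length x < cs.length (cs.simple i * x) ↔
        0 ≤ geomRep cs t (geomRep cs x⁻¹ (simpleRoot i))) := by
  have hr : IsRoot cs (geomRep cs t (geomRep cs x⁻¹ (simpleRoot i))) :=
    IsRoot.geomRep ⟨x⁻¹, i, rfl⟩ t
  rcases cs.length_simple_mul x i with h | h
  · rw [posRoot_conj_simple_of_lt (by omega)]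
    simp [show cs.length x < cs.length (cs.simple i * x) by omega]
  · rw [posRoot_conj_simple_of_gt (by omega), map_neg, ← hr.not_nonneg_iff]
    simp [show ¬ cs.length x < cs.length (cs.simple i * x) by omega]

lemma geomRep_conj_nonneg_iff {x t : W} {i : B} (ht : cs.IsReflection t) :
    0 ≤ geomRep cs t (posRoot cs (x⁻¹ * cs.simple i * x)) ↔
      (cs.length x < cs.length (cs.simple i * x) ↔
        cs.length (x * t) < cs.length (cs.simple i * (x * t))) := by
  rw [geomRep_nonneg_iff, length_lt_mul_left_iff (cs.isReflection_simple i) (x * t),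
    posRoot_simple, mul_inv_rev, ht.inv, geomRep_mul]

lemma isReflOrder_keyVec [LinearOrder B] (b : W) : IsReflOrder cs (fun t => toLex (keyVec cs b t)) where
  inj hr ht h := keyVec_injective hr ht b (toLex_inj.mp h)
  conj_same {x t i} ht _ hl := by
    have hr := isReflection_conj_simple (cs := cs) x i
    rw [← geomRep_conj_nonneg_iff ht] at hl
    rw [conj_mul_eq ht, toLex_lt_iff, toLex_lt_iff, ← lexPos_smul_iff (hgt_posRoot_pos hr),
      ← keyVec_conj_of_nonneg hr ht b hl, lexPos_smul_iff]
    apply hgt_posRoot_pos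
    simpa [ht.inv] using hr.conj t
  conj_opp {x t i} ht _ hl := by
    have hr := isReflection_conj_simple (cs := cs) x i
    rw [← geomRep_conj_nonneg_iff ht] at hl
    rw [conj_mul_eq ht, toLex_lt_iff, toLex_lt_iff, ← lexPos_smul_iff (hgt_posRoot_pos hr),
      ← keyVec_conj_of_not_nonneg hr ht b hl, lexPos_smul_iff]
    apply hgt_posRoot_pos
    simpa [ht.inv] using hr.conj t

variable (cs) in
/-- Compatibility of a reflection order with two-step paths: a path traversed in decreasing
order starts later than a path with the same ends traversed in increasing order. -/
def RankTwo {K : Type} [LinearOrder K] (κ : W → K) : Prop :=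
  ∀ {y t₁ t₂ r₁ r₂ : W}, cs.IsReflection t₁ → cs.IsReflection t₂ → cs.IsReflection r₁ →
    cs.IsReflection r₂ → y * t₁ * t₂ = y * r₁ * r₂ →
    (cs.length (y * t₁) < cs.length y ∧ cs.length (y * t₁ * t₂) < cs.length (y * t₁) ∧
        cs.length (y * r₁) < cs.length y ∧ cs.length (y * r₁ * r₂) < cs.length (y * r₁)) ∨
      (cs.length y < cs.length (y * t₁) ∧ cs.length (y * t₁) < cs.length (y * t₁ * t₂) ∧
        cs.length y < cs.length (y * r₁) ∧ cs.length (y * r₁) < cs.length (y * r₁ * r₂)) →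
    κ t₂ < κ t₁ → κ r₁ < κ r₂ → κ r₁ < κ t₁

variable (cs) in
/-- The left inversions of `b` form a final segment for `κ`. -/
def InvFinal {K : Type} [LinearOrder K] (κ : W → K) (b : W) : Prop :=
  ∀ {r t : W}, cs.IsReflection r → cs.IsReflection t → κ r < κ t →
    cs.length (r * b) < cs.length b → cs.length (t * b) < cs.length b

variable (cs) in
lemma exists_reflOrders : ∃ (K : Type) (_ : LinearOrder K) (κ : W → W → K),
    ∀ b, IsReflOrder cs (κ b) ∧ RankTwo cs (κ b) ∧ InvFinal cs (κ b) b := by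
  let _ : LinearOrder B := linearOrderOfSTO WellOrderingRel
  refine ⟨Lex (GeomSpace B), inferInstance, fun b t => toLex (keyVec cs b t), fun b => ⟨?_, ?_, ?_⟩⟩
  · exact isReflOrder_keyVec b
  · intro y t₁ t₂ r₁ r₂ ht₁ ht₂ hr₁ hr₂ he hl h₁ h₂
    rw [toLex_lt_iff] at *
    exact keyVec_rank_two b ht₁ ht₂ hr₁ hr₂ he hl h₁ h₂
  · intro r t hr ht h hN
    rw [toLex_lt_iff] at h
    exact keyVec_final hr ht h hN

/-! ### The Bruhat order through chains -/

variable (cs) in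
/-- An upward Bruhat step from `x` to `y`. -/
def BStep (x y : W) : Prop :=
  ∃ t, cs.IsReflection t ∧ y = x * t ∧ cs.length y = cs.length x + 1

variable (cs) in
/-- Reachability by upward Bruhat steps. -/
def ChainLE (x y : W) : Prop := Relation.ReflTransGen (BStep cs) x y

lemma ChainLE.refl (x : W) : ChainLE cs x x := Relation.ReflTransGen.refl

lemma ChainLE.trans {x y z : W} (h : ChainLE cs x y) (h' : ChainLE cs y z) : ChainLE cs x z :=
  Relation.ReflTransGen.trans h h'

lemma BStep.chainLE {x y : W} (h : BStep cs x y) : ChainLE cs x y :=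
  Relation.ReflTransGen.single h

lemma ChainLE.length_le {x y : W} (h : ChainLE cs x y) : cs.length x ≤ cs.length y := by
  induction h with
  | refl => exact le_rfl
  | tail _ h ih => obtain ⟨t, _, _, h⟩ := h; omega

lemma ChainLE.length_lt {x y : W} (h : ChainLE cs x y) (hne : x ≠ y) :
    cs.length x < cs.length y := by
  rcases Relation.ReflTransGen.cases_head h with rfl | ⟨z, ⟨t, _, _, hl⟩, h'⟩
  · exact absurd rfl hne
  · have := ChainLE.length_le h'
    omega

lemma ChainLE.antisymm {x y : W} (h : ChainLE cs x y) (h' : ChainLE cs y x) : x = y := by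
  by_contra hne
  have := h.length_lt hne
  have := h'.length_le
  omega

lemma bStep_mul {x t : W} (ht : cs.IsReflection t) (h : cs.length (x * t) = cs.length x + 1) :
    BStep cs x (x * t) := ⟨t, ht, rfl, h⟩

lemma bStep_simple {x : W} {i : B} (h : cs.length x < cs.length (cs.simple i * x)) :
    BStep cs x (cs.simple i * x) := by
  refine ⟨x⁻¹ * cs.simple i * x, isReflection_conj_simple x i, by group, ?_⟩
  rcases cs.length_simple_mul x i with h | h <;> omega

lemma bStep_simple' {x : W} {i : B} (h : cs.length (cs.simple i * x) < cs.length x) :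
    BStep cs (cs.simple i * x) x := by
  have := bStep_simple (cs := cs) (x := cs.simple i * x) (i := i)
    (by rwa [cs.simple_mul_simple_cancel_left])
  rwa [cs.simple_mul_simple_cancel_left] at this

variable (cs) in
/-- The smaller of `x` and `s x`. -/
noncomputable def smin (i : B) (x : W) : W :=
  if cs.length (cs.simple i * x) < cs.length x then cs.simple i * x else x

variable (cs) in
/-- The larger of `x` and `s x`. -/
noncomputable def smax (i : B) (x : W) : W :=
  if cs.length (cs.simple i * x) < cs.length x then x else cs.simple i * x

lemma smin_of_lt {i : B} {x : W} (h : cs.length (cs.simple i * x) < cs.length x) :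
    smin cs i x = cs.simple i * x := if_pos h

lemma smin_of_gt {i : B} {x : W} (h : cs.length x < cs.length (cs.simple i * x)) :
    smin cs i x = x := if_neg (not_lt.mpr h.le)

lemma smax_of_lt {i : B} {x : W} (h : cs.length (cs.simple i * x) < cs.length x) :
    smax cs i x = x := if_pos h

lemma smax_of_gt {i : B} {x : W} (h : cs.length x < cs.length (cs.simple i * x)) :
    smax cs i x = cs.simple i * x := if_neg (not_lt.mpr h.le)

lemma simple_lt_or_gt (i : B) (x : W) : cs.length (cs.simple i * x) < cs.length x ∨
    cs.length x < cs.length (cs.simple i * x) := by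
  rcases cs.length_simple_mul x i with h | h <;> omega

lemma smin_le (i : B) (x : W) : ChainLE cs (smin cs i x) x := by
  rcases simple_lt_or_gt (cs := cs) i x with h | h
  · rw [smin_of_lt h]; exact (bStep_simple' h).chainLE
  · rw [smin_of_gt h]; exact .refl x

lemma le_smax (i : B) (x : W) : ChainLE cs x (smax cs i x) := by
  rcases simple_lt_or_gt (cs := cs) i x with h | h
  · rw [smax_of_lt h]; exact .refl x
  · rw [smax_of_gt h]; exact (bStep_simple h).chainLE

lemma simple_mul_le_smax (i : B) (x : W) : ChainLE cs (cs.simple i * x) (smax cs i x) := by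
  rcases simple_lt_or_gt (cs := cs) i x with h | h
  · rw [smax_of_lt h]; exact (bStep_simple' h).chainLE
  · rw [smax_of_gt h]; exact .refl _

/-- A Bruhat step either is multiplication by `s` or is preserved by multiplication by `s`
when `s` acts in the same direction on both ends. -/
lemma BStep.lift {x y : W} (h : BStep cs x y) (i : B) :
    (y = cs.simple i * x) ∨
      (¬ (cs.length x < cs.length (cs.simple i * x) ∧
        cs.length (cs.simple i * y) < cs.length y) ∧
      ((cs.length x < cs.length (cs.simple i * x) ↔ cs.length y < cs.length (cs.simple i * y)) →
        BStep cs (cs.simple i * x) (cs.simple i * y))) := by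
  obtain ⟨t, ht, rfl, hl⟩ := h
  by_cases hne : t = x⁻¹ * cs.simple i * x
  · left; rw [hne]; group
  right
  have h0 := length_lt_mul_iff_simple ht i hne
  rw [mul_assoc] at h0
  have h1 := cs.length_simple_mul x i
  have h2 := cs.length_simple_mul (x * t) i
  constructor
  · omega
  · intro hiff
    refine ⟨t, ht, (mul_assoc _ _ _).symm, ?_⟩
    omega

lemma BStep.smin_le {x y : W} (h : BStep cs x y) (i : B) :
    ChainLE cs (smin cs i x) (smin cs i y) := by
  have hl := h.lift i
  rcases simple_lt_or_gt (cs := cs) i x with h1 | h1 <;>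
    rcases simple_lt_or_gt (cs := cs) i y with h2 | h2
  · rw [smin_of_lt h1, smin_of_lt h2]
    rcases hl with rfl | ⟨_, h3⟩
    · rw [cs.simple_mul_simple_cancel_left] at h2; omega
    · exact (h3 (by constructor <;> intro <;> omega)).chainLE
  · rw [smin_of_gt h2]
    exact (TwistedTP.smin_le i x).trans h.chainLE
  · rw [smin_of_gt h1, smin_of_lt h2]
    rcases hl with rfl | ⟨h3, _⟩
    · rw [cs.simple_mul_simple_cancel_left]; exact .refl x
    · exact absurd ⟨h1, h2⟩ h3
  · rw [smin_of_gt h1, smin_of_gt h2]; exact h.chainLE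

lemma BStep.smax_le {x y : W} (h : BStep cs x y) (i : B) :
    ChainLE cs (smax cs i x) (smax cs i y) := by
  have hl := h.lift i
  rcases simple_lt_or_gt (cs := cs) i x with h1 | h1 <;>
    rcases simple_lt_or_gt (cs := cs) i y with h2 | h2
  · rw [smax_of_lt h1, smax_of_lt h2]; exact h.chainLE
  · rw [smax_of_lt h1]
    exact h.chainLE.trans (le_smax i y)
  · rw [smax_of_gt h1, smax_of_lt h2]
    rcases hl with rfl | ⟨h3, _⟩
    · exact .refl _
    · exact absurd ⟨h1, h2⟩ h3
  · rw [smax_of_gt h1, smax_of_gt h2]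
    rcases hl with rfl | ⟨_, h3⟩
    · rw [cs.simple_mul_simple_cancel_left] at h2; omega
    · exact (h3 (by constructor <;> intro <;> assumption)).chainLE

lemma ChainLE.smin {x y : W} (h : ChainLE cs x y) (i : B) :
    ChainLE cs (smin cs i x) (smin cs i y) := by
  induction h with
  | refl => exact .refl _
  | tail _ h ih => exact ih.trans (h.smin_le i)

lemma ChainLE.smax {x y : W} (h : ChainLE cs x y) (i : B) :
    ChainLE cs (smax cs i x) (smax cs i y) := by
  induction h with
  | refl => exact .refl _
  | tail _ h ih => exact ih.trans (h.smax_le i)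

lemma ChainLE.simple_mul_le {x y : W} (h : ChainLE cs x y) {i : B}
    (hy : cs.length y < cs.length (cs.simple i * y)) :
    ChainLE cs (cs.simple i * x) (cs.simple i * y) := by
  have := (simple_mul_le_smax i x).trans (h.smax i)
  rwa [smax_of_gt hy] at this

variable (cs) in
/-- Successive left multiplications by the letters of a word, performed when they
decrease the length. -/
noncomputable def greedy : List B → W → W
  | [], x => x
  | i :: ω, x => greedy ω (smin cs i x)

lemma isReduced_cons_iff {i : B} {ω : List B} : cs.IsReduced (i :: ω) ↔
    cs.IsReduced ω ∧ cs.length (cs.wordProd ω) < cs.length (cs.simple i * cs.wordProd ω) := by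
  rw [CoxeterSystem.IsReduced, CoxeterSystem.IsReduced, cs.wordProd_cons, List.length_cons]
  have h1 := cs.length_wordProd_le ω
  have h2 := cs.length_simple_mul (cs.wordProd ω) i
  omega

lemma ChainLE.greedy {x y : W} (h : ChainLE cs x y) (ω : List B) :
    ChainLE cs (greedy cs ω x) (greedy cs ω y) := by
  induction ω generalizing x y with
  | nil => exact h
  | cons i ω ih => exact ih (h.smin i)

lemma greedy_wordProd {ω : List B} (hω : cs.IsReduced ω) :
    greedy cs ω (cs.wordProd ω) = 1 := by
  induction ω with
  | nil => simp [greedy]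
  | cons i ω ih =>
    obtain ⟨h1, h2⟩ := isReduced_cons_iff.mp hω
    rw [cs.wordProd_cons, greedy, smin_of_lt (by rwa [cs.simple_mul_simple_cancel_left]),
      cs.simple_mul_simple_cancel_left, ih h1]

lemma chainLE_one {x : W} : ChainLE cs x 1 ↔ x = 1 := by
  constructor
  · intro h
    have := h.length_le
    rw [cs.length_one] at this
    exact cs.length_eq_zero_iff.mp (by omega)
  · rintro rfl; exact .refl 1

lemma exists_sublist_greedy (ω : List B) (x : W) : ∃ ω' : List B, ω'.Sublist ω ∧
    x = cs.wordProd ω' * greedy cs ω x ∧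
    cs.length x = cs.length (cs.wordProd ω') + cs.length (greedy cs ω x) := by
  induction ω generalizing x with
  | nil => exact ⟨[], List.Sublist.refl _, by simp [greedy], by simp [greedy]⟩
  | cons i ω ih =>
    obtain ⟨ω', h1, h2, h3⟩ := ih (smin cs i x)
    rcases simple_lt_or_gt (cs := cs) i x with h | h
    · refine ⟨i :: ω', h1.cons_cons i, ?_, ?_⟩
      · rw [greedy, cs.wordProd_cons, mul_assoc, ← h2, smin_of_lt h,
          cs.simple_mul_simple_cancel_left]
      · rw [greedy]
        rw [cs.wordProd_cons]
        have e : x = cs.simple i * cs.wordProd ω' * greedy cs ω (smin cs i x) := by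
          rw [mul_assoc, ← h2, smin_of_lt h, cs.simple_mul_simple_cancel_left]
        have l1 := cs.length_mul_le (cs.simple i * cs.wordProd ω') (greedy cs ω (smin cs i x))
        rw [← e] at l1
        rw [smin_of_lt h] at *
        have l2 := cs.length_simple_mul (cs.wordProd ω') i
        omega
    · rw [greedy]
      rw [smin_of_gt h] at *
      exact ⟨ω', h1.cons i, h2, h3⟩

lemma chainLE_of_sublist {ω ω' : List B} (hω : cs.IsReduced ω) (h : ω'.Sublist ω) :
    ChainLE cs (cs.wordProd ω') (cs.wordProd ω) := by
  induction h with
  | slnil => exact .refl _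
  | cons i h ih =>
    obtain ⟨h1, h2⟩ := isReduced_cons_iff.mp hω
    rw [cs.wordProd_cons]
    exact (ih h1).trans (bStep_simple h2).chainLE
  | cons_cons i h ih =>
    obtain ⟨h1, h2⟩ := isReduced_cons_iff.mp hω
    rw [cs.wordProd_cons, cs.wordProd_cons]
    exact (ih h1).simple_mul_le h2

lemma chainLE_wordProd_iff {ω : List B} (hω : cs.IsReduced ω) {x : W} :
    ChainLE cs x (cs.wordProd ω) ↔ greedy cs ω x = 1 := by
  constructor
  · intro h
    have := h.greedy ω
    rwa [greedy_wordProd hω, chainLE_one] at this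
  · intro h
    obtain ⟨ω', h1, h2, _⟩ := exists_sublist_greedy (cs := cs) ω x
    rw [h, mul_one] at h2
    rw [h2]
    exact chainLE_of_sublist hω h1

lemma ChainLE.exists_sublist {ω : List B} (hω : cs.IsReduced ω) {x : W}
    (h : ChainLE cs x (cs.wordProd ω)) : ∃ ω' : List B, ω'.Sublist ω ∧ cs.wordProd ω' = x := by
  obtain ⟨ω', h1, h2, _⟩ := exists_sublist_greedy (cs := cs) ω x
  rw [(chainLE_wordProd_iff hω).mp h, mul_one] at h2
  exact ⟨ω', h1, h2.symm⟩

lemma bruhatLE_iff {x y : W} : bruhatLE cs x y ↔ ChainLE cs x y := by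
  constructor
  · rintro ⟨ω, hω, rfl, ω', h, rfl⟩
    exact chainLE_of_sublist hω h
  · intro h
    obtain ⟨ω, hω, rfl⟩ := cs.exists_isReduced y
    exact ⟨ω, hω, rfl, h.exists_sublist hω⟩

lemma ChainLE.inv {x y : W} (h : ChainLE cs x y) : ChainLE cs x⁻¹ y⁻¹ := by
  obtain ⟨ω, hω, rfl, ω', hs, rfl⟩ := bruhatLE_iff.mpr h
  rw [← cs.wordProd_reverse, ← cs.wordProd_reverse]
  exact chainLE_of_sublist hω.reverse (List.reverse_sublist.mpr hs)

lemma chainLE_inv_iff {x y : W} : ChainLE cs x⁻¹ y⁻¹ ↔ ChainLE cs x y :=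
  ⟨fun h => by simpa using h.inv, fun h => h.inv⟩

lemma finite_chainLE (y : W) : {x | ChainLE cs x y}.Finite := by
  obtain ⟨ω, hω, rfl⟩ := cs.exists_isReduced y
  refine ((List.finite_toSet ω.sublists).image cs.wordProd).subset ?_
  intro x hx
  obtain ⟨ω', h, e⟩ := ChainLE.exists_sublist hω hx
  exact ⟨ω', List.mem_sublists.mpr h, e⟩

lemma ChainLE.exists_step {x y : W} (h : ChainLE cs x y) (hne : x ≠ y) :
    ∃ z, BStep cs x z ∧ ChainLE cs z y := by
  rcases Relation.ReflTransGen.cases_head h with rfl | ⟨z, h1, h2⟩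
  · exact absurd rfl hne
  · exact ⟨z, h1, h2⟩

lemma ChainLE.exists_step' {x y : W} (h : ChainLE cs x y) (hne : x ≠ y) :
    ∃ z, ChainLE cs x z ∧ BStep cs z y := by
  rcases Relation.ReflTransGen.cases_tail h with rfl | ⟨z, h1, h2⟩
  · exact absurd rfl hne
  · exact ⟨z, h1, h2⟩

/-! ### Counting paths with ordered labels -/

variable (cs) in
/-- `ts` is the list of labels of a path of upward Bruhat steps from `x` to `y`. -/
def UpPath : W → List W → W → Prop
  | x, [], y => x = y
  | x, t :: ts, y => cs.IsReflection t ∧ cs.length (x * t) = cs.length x + 1 ∧ UpPath (x * t) ts y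

variable (cs) in
/-- The number of sublists of a given list of reflections which label an upward path
from `x` to `y`. -/
noncomputable def cnt : List W → W → W → ℕ
  | [], y, x => if x = y then 1 else 0
  | t :: F, y, x =>
    cnt F y x + if cs.length (x * t) = cs.length x + 1 then cnt F y (x * t) else 0

lemma UpPath.chainLE {x y : W} {ts : List W} (h : UpPath cs x ts y) : ChainLE cs x y := by
  induction ts generalizing x with
  | nil => rw [UpPath] at h; subst h; exact .refl _
  | cons t ts ih => exact (bStep_mul h.1 h.2.1).chainLE.trans (ih h.2.2)

lemma exists_upPath_of_cnt_ne_zero {F : List W} (hF : ∀ t ∈ F, cs.IsReflection t) {x y : W}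
    (h : cnt cs F y x ≠ 0) : ∃ ts : List W, ts.Sublist F ∧ UpPath cs x ts y := by
  induction F generalizing x with
  | nil =>
    refine ⟨[], List.Sublist.refl _, ?_⟩
    rw [cnt] at h
    simpa [UpPath] using h
  | cons t F ih =>
    have hF' : ∀ t ∈ F, cs.IsReflection t := fun t ht => hF t (List.mem_cons_of_mem _ ht)
    rw [cnt] at h
    by_cases h1 : cnt cs F y x = 0
    · rw [h1, zero_add] at h
      split_ifs at h with h2
      · obtain ⟨ts, h3, h4⟩ := ih hF' h
        exact ⟨t :: ts, h3.cons_cons t, hF t List.mem_cons_self, h2, h4⟩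
      · exact absurd rfl h
    · obtain ⟨ts, h3, h4⟩ := ih hF' h1
      exact ⟨ts, h3.cons t, h4⟩

lemma cnt_ne_zero_of_upPath {F ts : List W} {x y : W} (hs : ts.Sublist F)
    (h : UpPath cs x ts y) : cnt cs F y x ≠ 0 := by
  induction hs generalizing x with
  | slnil => simpa [cnt, UpPath] using h
  | cons t hs ih =>
    rw [cnt]
    have := ih h
    omega
  | cons_cons t hs ih =>
    rw [cnt, if_pos h.2.1]
    have := ih h.2.2
    omega

lemma upPath_unique {F ts ts' : List W} {x y : W} (hc : cnt cs F y x ≤ 1) (hs : ts.Sublist F)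
    (h : UpPath cs x ts y) (hs' : ts'.Sublist F) (h' : UpPath cs x ts' y) : ts = ts' := by
  induction F generalizing x ts ts' with
  | nil => rw [List.sublist_nil.mp hs, List.sublist_nil.mp hs']
  | cons t F ih =>
    rw [cnt] at hc
    cases hs with
    | cons _ hs =>
      cases hs' with
      | cons _ hs' => exact ih (by omega) hs h hs' h'
      | cons_cons _ hs' =>
        have h1 := cnt_ne_zero_of_upPath hs h
        have h2 := cnt_ne_zero_of_upPath hs' h'.2.2
        rw [if_pos h'.2.1] at hc
        omega
    | cons_cons _ hs =>
      rw [if_pos h.2.1] at hc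
      cases hs' with
      | cons _ hs' =>
        have h1 := cnt_ne_zero_of_upPath hs' h'
        have h2 := cnt_ne_zero_of_upPath hs h.2.2
        omega
      | cons_cons _ hs' => rw [ih (by omega) hs h.2.2 hs' h'.2.2]

lemma chainLE_of_cnt_ne_zero {F : List W} (hF : ∀ t ∈ F, cs.IsReflection t) {x y : W}
    (h : cnt cs F y x ≠ 0) : ChainLE cs x y := by
  obtain ⟨ts, _, h⟩ := exists_upPath_of_cnt_ne_zero hF h
  exact h.chainLE

lemma cnt_self {F : List W} (hF : ∀ t ∈ F, cs.IsReflection t) (x : W) : cnt cs F x x = 1 := by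
  induction F with
  | nil => simp [cnt]
  | cons t F ih =>
    have hF' : ∀ t ∈ F, cs.IsReflection t := fun t ht => hF t (List.mem_cons_of_mem _ ht)
    rw [cnt, ih hF']
    split_ifs with h
    · have : cnt cs F x (x * t) = 0 := by
        by_contra h'
        have := (chainLE_of_cnt_ne_zero hF' h').length_le
        omega
      rw [this]
    · rfl

variable (cs) in
/-- The reflections `r` occurring as `x⁻¹ z` with `x, z` below `A`. -/
def RelRefl (A r : W) : Prop :=
  cs.IsReflection r ∧ ∃ x, ChainLE cs x A ∧ ChainLE cs (x * r) A

lemma relRefl_conj {A x : W} {i : B} (h : ChainLE cs x A) (h' : ChainLE cs (cs.simple i * x) A) :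
    RelRefl cs A (x⁻¹ * cs.simple i * x) :=
  ⟨isReflection_conj_simple x i, x, h, by rwa [← mul_assoc, mul_inv_cancel_left]⟩

/-- How the number of ordered paths changes when the upper end is multiplied by a simple
reflection. -/
lemma cnt_simple_mul {K : Type} [LinearOrder K] {κ : W → K} (hκ : IsReflOrder cs κ) {i : B}
    {y A : W} (hy : cs.length y < cs.length (cs.simple i * y))
    (hA : ChainLE cs (cs.simple i * y) A) (F : List W) (hF : ∀ t ∈ F, cs.IsReflection t)
    (hs : F.Pairwise (fun a b => κ b < κ a))
    (hI : ∀ t ∈ F, ∀ r, RelRefl cs A r → κ r < κ t → r ∈ F) (x : W) :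
    (cs.length x < cs.length (cs.simple i * x) → cnt cs F (cs.simple i * y) x =
      if x⁻¹ * cs.simple i * x ∈ F then cnt cs F y x else 0) ∧
    (cs.length (cs.simple i * x) < cs.length x → cnt cs F (cs.simple i * y) x =
      cnt cs F y (cs.simple i * x) +
        if x⁻¹ * cs.simple i * x ∈ F then 0 else cnt cs F y x) := by
  induction F generalizing x with
  | nil =>
    simp only [cnt, List.not_mem_nil, if_false]
    constructor
    · intro h
      rw [if_neg]
      rintro rfl
      rw [cs.simple_mul_simple_cancel_left] at h
      omega
    · intro h
      rw [if_neg (c := x = y) (by rintro rfl; omega)]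
      have : x = cs.simple i * y ↔ cs.simple i * x = y := by
        constructor
        · rintro rfl; rw [cs.simple_mul_simple_cancel_left]
        · rintro rfl; rw [cs.simple_mul_simple_cancel_left]
      simp [this]
  | cons t F ih =>
    have ht : cs.IsReflection t := hF t List.mem_cons_self
    have hF' : ∀ t ∈ F, cs.IsReflection t := fun t ht => hF t (List.mem_cons_of_mem _ ht)
    obtain ⟨hlt, hs'⟩ := List.pairwise_cons.mp hs
    have htF : t ∉ F := fun h => lt_irrefl _ (hlt t h)
    have hmem : ∀ r, RelRefl cs A r → r ≠ t → (r ∈ F ↔ κ r < κ t) := fun r hr hrt =>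
      ⟨fun h => hlt r h, fun h =>
        (List.mem_cons.mp (hI t List.mem_cons_self r hr h)).resolve_left hrt⟩
    have hI' : ∀ t ∈ F, ∀ r, RelRefl cs A r → κ r < κ t → r ∈ F := by
      intro u hu r hr hru
      refine (List.mem_cons.mp (hI u (List.mem_cons_of_mem _ hu) r hr hru)).resolve_left ?_
      rintro rfl
      exact lt_asymm hru (hlt u hu)
    have ih := ih hF' hs' hI'
    by_cases hr : t = x⁻¹ * cs.simple i * x
    · have hxt : x * t = cs.simple i * x := by rw [hr]; group
      have hsxt : cs.simple i * x * t = x := by rw [mul_assoc, hxt, cs.simple_mul_simple_cancel_left]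
      have hr' : (cs.simple i * x)⁻¹ * cs.simple i * (cs.simple i * x) = t := by
        rw [hr]; simp [mul_assoc]
      constructor
      · intro h
        have hl : cs.length (cs.simple i * x) = cs.length x + 1 := by
          rcases cs.length_simple_mul x i with h | h <;> omega
        rw [← hr, if_pos List.mem_cons_self, cnt, cnt, hxt, if_pos hl, if_pos hl,
          (ih x).1 h, ← hr, if_neg htF, (ih _).2 (by rwa [cs.simple_mul_simple_cancel_left]),
          hr', if_neg htF, cs.simple_mul_simple_cancel_left]
        omega
      · intro h
        have hl : cs.length x = cs.length (cs.simple i * x) + 1 := by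
          rcases cs.length_simple_mul x i with h | h <;> omega
        rw [← hr, if_pos List.mem_cons_self, cnt, cnt, hxt, hsxt,
          if_neg (c := cs.length (cs.simple i * x) = cs.length x + 1) (by omega), if_pos hl,
          (ih x).2 h, ← hr, if_neg htF]
    · have h0 := length_lt_mul_iff_simple ht i hr
      have e1 := cs.length_simple_mul x i
      have e2 := cs.length_simple_mul (x * t) i
      have hxr : x⁻¹ * cs.simple i * x ∈ t :: F ↔ x⁻¹ * cs.simple i * x ∈ F := by
        rw [List.mem_cons, or_iff_right (Ne.symm hr)]
      rw [mul_assoc] at h0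
      simp only [hxr, cnt]
      have hrel : BStep cs x (x * t) → cnt cs F y (x * t) ≠ 0 →
          RelRefl cs A (x⁻¹ * cs.simple i * x) ∧
          RelRefl cs A ((x * t)⁻¹ * cs.simple i * (x * t)) := by
        intro hst hc
        have h1 := chainLE_of_cnt_ne_zero hF' hc
        have h2 := hst.chainLE.trans h1
        have h3 : ChainLE cs y A := (bStep_simple hy).chainLE.trans hA
        exact ⟨relRefl_conj (h2.trans h3) ((h2.simple_mul_le hy).trans hA),
          relRefl_conj (h1.trans h3) ((h1.simple_mul_le hy).trans hA)⟩
      have hsame : (cs.length x < cs.length (cs.simple i * x) ↔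
          cs.length (x * t) < cs.length (cs.simple i * (x * t))) → BStep cs x (x * t) →
          cnt cs F y (x * t) ≠ 0 →
          (x⁻¹ * cs.simple i * x ∈ F ↔ (x * t)⁻¹ * cs.simple i * (x * t) ∈ F) := by
        intro hl hst hc
        obtain ⟨h1, h2⟩ := hrel hst hc
        rw [hmem _ h1 (Ne.symm hr), hmem _ h2 (Ne.symm (conj_mul_ne ht hr)),
          hκ.conj_same ht hr hl]
      have hopp : ¬ (cs.length x < cs.length (cs.simple i * x) ↔
          cs.length (x * t) < cs.length (cs.simple i * (x * t))) → BStep cs x (x * t) →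
          cnt cs F y (x * t) ≠ 0 →
          (x⁻¹ * cs.simple i * x ∈ F ↔ ¬ (x * t)⁻¹ * cs.simple i * (x * t) ∈ F) := by
        intro hl hst hc
        obtain ⟨h1, h2⟩ := hrel hst hc
        have hne := conj_mul_ne ht hr
        rw [hmem _ h1 (Ne.symm hr), hmem _ h2 (Ne.symm hne), hκ.conj_opp ht hr hl,
          not_lt_iff_of_ne]
        exact fun e => hne (hκ.inj ht h2.1 e)
      constructor
      · intro h
        rw [(ih x).1 h]
        by_cases hup : cs.length (x * t) = cs.length x + 1
        · have h' : cs.length (x * t) < cs.length (cs.simple i * (x * t)) := by omega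
          rw [if_pos hup, if_pos hup, (ih (x * t)).1 h']
          by_cases hc : cnt cs F y (x * t) = 0
          · simp [hc]
          · have := hsame (by constructor <;> intro <;> assumption) (bStep_mul ht hup) hc
            simp only [← this]
            split_ifs <;> rfl
        · rw [if_neg hup, if_neg hup]
          rfl
      · intro h
        rw [(ih x).2 h, mul_assoc (cs.simple i) x t]
        have hx1 : cs.length x = cs.length (cs.simple i * x) + 1 := by omega
        rcases simple_lt_or_gt (cs := cs) i (x * t) with h' | h'
        · have hiff : cs.length (cs.simple i * (x * t)) = cs.length (cs.simple i * x) + 1 ↔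
              cs.length (x * t) = cs.length x + 1 := by omega
          simp only [hiff]
          by_cases hup : cs.length (x * t) = cs.length x + 1
          · rw [if_pos hup, if_pos hup, if_pos hup, (ih (x * t)).2 h']
            by_cases hc : cnt cs F y (x * t) = 0
            · rw [hc]
              split_ifs <;> omega
            · have := hsame (by constructor <;> intro <;> omega) (bStep_mul ht hup) hc
              simp only [← this]
              split_ifs <;> omega
          · rw [if_neg hup, if_neg hup, if_neg hup]
            rfl
        · rw [if_neg (c := cs.length (cs.simple i * (x * t)) = cs.length (cs.simple i * x) + 1)
            (by omega)]
          by_cases hup : cs.length (x * t) = cs.length x + 1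
          · rw [if_pos hup, if_pos hup, (ih (x * t)).1 h']
            by_cases hc : cnt cs F y (x * t) = 0
            · simp [hc]
            · have := hopp (by omega) (bStep_mul ht hup) hc
              by_cases hm : (x * t)⁻¹ * cs.simple i * (x * t) ∈ F
              · have hm' := fun h => this.mp h hm
                rw [if_pos hm, if_neg hm', if_neg hm']
                omega
              · have hm' := this.mpr hm
                rw [if_neg hm, if_pos hm', if_pos hm']
          · rw [if_neg hup, if_neg hup]
            rfl

/-- The number of ordered paths avoiding the left inversions of `b` is `0` or `1`, as decided
by the greedy product. -/
lemma cnt_eq_greedy {K : Type} [LinearOrder K] {κ : W → K} (hκ : IsReflOrder cs κ) {A b : W}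
    {F : List W} (hF : ∀ t, t ∈ F ↔ RelRefl cs A t ∧ ¬ cs.length (t * b) < cs.length b)
    (hs : F.Pairwise (fun a b => κ b < κ a)) (hN : InvFinal cs κ b) {ω : List B}
    (hω : cs.IsReduced ω) (hA : ChainLE cs (cs.wordProd ω) A) {x : W}
    (hx : cs.length (x * b) = cs.length x + cs.length b) :
    cnt cs F (cs.wordProd ω) x = if greedy cs ω (x * b) = b then 1 else 0 := by
  have hF' : ∀ t ∈ F, cs.IsReflection t := fun t ht => ((hF t).mp ht).1.1
  have hI : ∀ t ∈ F, ∀ r, RelRefl cs A r → κ r < κ t → r ∈ F := by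
    intro t ht r hr h
    refine (hF r).mpr ⟨hr, fun hb => ((hF t).mp ht).2 (hN hr.1 (hF' t ht) h hb)⟩
  induction ω generalizing x with
  | nil =>
    rw [cs.wordProd_nil, greedy]
    by_cases h1 : x = 1
    · subst h1; simp [cnt_self hF']
    · have : cnt cs F 1 x = 0 := by
        by_contra hc
        exact h1 (chainLE_one.mp (chainLE_of_cnt_ne_zero hF' hc))
      simp [this, h1]
  | cons i ω ih =>
    obtain ⟨hω', hl⟩ := isReduced_cons_iff.mp hω
    rw [cs.wordProd_cons] at hA ⊢
    have hA' : ChainLE cs (cs.wordProd ω) A := (bStep_simple hl).chainLE.trans hA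
    have ih := fun {x : W} hx => ih hω' hA' (x := x) hx
    have hrec := cnt_simple_mul hκ hl hA F hF' hs hI x
    have hrel : cnt cs F (cs.wordProd ω) x ≠ 0 → RelRefl cs A (x⁻¹ * cs.simple i * x) := by
      intro hc
      have h1 := chainLE_of_cnt_ne_zero hF' hc
      exact relRefl_conj (h1.trans hA') ((h1.simple_mul_le hl).trans hA)
    rw [greedy]
    have e1 := cs.length_simple_mul x i
    have e2 := cs.length_simple_mul (x * b) i
    have e3 := cs.length_mul_le (cs.simple i * x) b
    rw [mul_assoc] at e3
    rcases simple_lt_or_gt (cs := cs) i x with h | h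
    · have hb := length_conj_mul_lt_iff_of_gt b h
      rw [mul_assoc (cs.simple i) x b] at hb
      rw [hrec.2 h, smin_of_lt (by omega), ih (by rw [mul_assoc]; omega), mul_assoc]
      have : (if x⁻¹ * cs.simple i * x ∈ F then 0 else cnt cs F (cs.wordProd ω) x) = 0 := by
        split_ifs with hm
        · rfl
        · by_contra hc
          refine hm ((hF _).mpr ⟨hrel hc, ?_⟩)
          rw [hb]; omega
      rw [this, add_zero]
    · have hb := length_conj_mul_lt_iff_of_lt b h
      rw [mul_assoc (cs.simple i) x b] at hb
      rw [hrec.1 h]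
      rcases simple_lt_or_gt (cs := cs) i (x * b) with h' | h'
      · rw [smin_of_lt h', if_neg, if_neg]
        · intro hg
          obtain ⟨ω', _, h1, h2⟩ := exists_sublist_greedy (cs := cs) ω (cs.simple i * (x * b))
          rw [hg] at h1 h2
          rw [← mul_assoc] at h1
          have := mul_right_cancel h1
          rw [← this] at h2
          omega
        · intro hm
          apply ((hF _).mp hm).2
          rw [hb]
          exact h'
      · rw [smin_of_gt h', ← ih hx]
        split_ifs with hm
        · rfl
        · by_contra hc
          refine hm ((hF _).mpr ⟨hrel (Ne.symm hc), ?_⟩)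
          rw [hb]
          omega

/-! ### Existence and uniqueness of ordered paths -/

lemma finite_relRefl (A : W) : {t | RelRefl cs A t}.Finite := by
  refine (((finite_chainLE (cs := cs) A).prod (finite_chainLE (cs := cs) A)).image
    (fun p : W × W => p.1⁻¹ * p.2)).subset ?_
  rintro t ⟨_, x, h1, h2⟩
  exact ⟨(x, x * t), ⟨h1, h2⟩, by simp⟩

lemma exists_sorted_list {K : Type} [LinearOrder K] {α : Type} {κ : α → K} {S : Set α} (hS : S.Finite)
    (hκ : Set.InjOn κ S) : ∃ F : List α, (∀ t, t ∈ F ↔ t ∈ S) ∧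
      F.Pairwise (fun a b => κ b < κ a) := by
  refine ⟨hS.toFinset.toList.insertionSort (fun a b => κ b ≤ κ a), fun t => by simp, ?_⟩
  have : Std.Total (fun a b : α => κ b ≤ κ a) := ⟨fun a b => le_total _ _⟩
  have : IsTrans α (fun a b : α => κ b ≤ κ a) := ⟨fun a b c h h' => h'.trans h⟩
  have h1 := List.pairwise_insertionSort (fun a b : α => κ b ≤ κ a) hS.toFinset.toList
  have h2 : (hS.toFinset.toList.insertionSort (fun a b => κ b ≤ κ a)).Nodup :=
    (List.perm_insertionSort _ _).nodup_iff.mpr (Finset.nodup_toList _)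
  refine List.Pairwise.imp_of_mem ?_ (h1.and h2)
  rintro a b ha hb ⟨h, hne⟩
  refine lt_of_le_of_ne h fun e => hne (hκ ?_ ?_ e.symm)
  · simpa using ha
  · simpa using hb

lemma sublist_of_sorted {K : Type} [LinearOrder K] {α : Type} {κ : α → K} {F ts : List α}
    (hF : F.Pairwise (fun a b => κ b < κ a)) (hts : ts.Pairwise (fun a b => κ b < κ a))
    (h : ∀ t ∈ ts, t ∈ F) : ts.Sublist F := by
  induction F generalizing ts with
  | nil => rw [List.eq_nil_iff_forall_not_mem.mpr (fun t ht => List.not_mem_nil (h t ht))]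
  | cons a F ih =>
    obtain ⟨h1, h2⟩ := List.pairwise_cons.mp hF
    cases ts with
    | nil => exact List.nil_sublist _
    | cons b ts =>
      obtain ⟨h3, h4⟩ := List.pairwise_cons.mp hts
      by_cases hab : b = a
      · subst hab
        refine (ih h2 h4 fun t ht => ?_).cons_cons b
        refine (List.mem_cons.mp (h t (List.mem_cons_of_mem _ ht))).resolve_left ?_
        rintro rfl
        exact lt_irrefl _ (h3 t ht)
      · have hb : b ∈ F := (List.mem_cons.mp (h b List.mem_cons_self)).resolve_left hab
        refine (ih h2 hts fun t ht => ?_).cons a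
        refine (List.mem_cons.mp (h t ht)).resolve_left ?_
        rintro rfl
        rcases List.mem_cons.mp ht with ht | ht
        · exact hab ht.symm
        · exact lt_asymm (h3 t ht) (h1 b hb)

lemma UpPath.relRefl {x y : W} {ts : List W} (h : UpPath cs x ts y) : ∀ t ∈ ts, RelRefl cs y t := by
  induction ts generalizing x with
  | nil => simp
  | cons a ts ih =>
    intro t ht
    rcases List.mem_cons.mp ht with rfl | ht
    · exact ⟨h.1, x, h.chainLE, h.2.2.chainLE⟩
    · exact ih h.2.2 t ht

/-- Ordered paths avoiding the left inversions of `b`, and the greedy product. -/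
lemma ordered_upPath {K : Type} [LinearOrder K] {κ : W → K} (hκ : IsReflOrder cs κ) {b : W}
    (hN : InvFinal cs κ b) {ω : List B} (hω : cs.IsReduced ω) {x : W}
    (hx : cs.length (x * b) = cs.length x + cs.length b) :
    ((∃ ts, UpPath cs x ts (cs.wordProd ω) ∧ ts.Pairwise (fun a b => κ b < κ a) ∧
        ∀ t ∈ ts, ¬ cs.length (t * b) < cs.length b) ↔ greedy cs ω (x * b) = b) ∧
    ∀ ts ts', UpPath cs x ts (cs.wordProd ω) ∧ ts.Pairwise (fun a b => κ b < κ a) ∧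
        (∀ t ∈ ts, ¬ cs.length (t * b) < cs.length b) →
      UpPath cs x ts' (cs.wordProd ω) ∧ ts'.Pairwise (fun a b => κ b < κ a) ∧
        (∀ t ∈ ts', ¬ cs.length (t * b) < cs.length b) → ts = ts' := by
  obtain ⟨F, hF, hs⟩ := exists_sorted_list (κ := κ)
    (S := {t | RelRefl cs (cs.wordProd ω) t ∧ ¬ cs.length (t * b) < cs.length b})
    ((finite_relRefl (cs := cs) (cs.wordProd ω)).subset fun t ht => ht.1)
    (fun t ht t' ht' e => hκ.inj ht.1.1 ht'.1.1 e)
  have hc := cnt_eq_greedy hκ hF hs hN hω (.refl _) hx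
  have hF' : ∀ t ∈ F, cs.IsReflection t := fun t ht => ((hF t).mp ht).1.1
  have hsub : ∀ ts, UpPath cs x ts (cs.wordProd ω) ∧ ts.Pairwise (fun a b => κ b < κ a) ∧
      (∀ t ∈ ts, ¬ cs.length (t * b) < cs.length b) → ts.Sublist F := fun ts h =>
    sublist_of_sorted hs h.2.1 fun t ht => (hF t).mpr ⟨h.1.relRefl t ht, h.2.2 t ht⟩
  refine ⟨⟨?_, ?_⟩, ?_⟩
  · rintro ⟨ts, h⟩
    have := cnt_ne_zero_of_upPath (hsub ts h) h.1
    by_contra hg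
    rw [hc, if_neg hg] at this
    exact this rfl
  · intro hg
    rw [if_pos hg] at hc
    obtain ⟨ts, h1, h2⟩ := exists_upPath_of_cnt_ne_zero hF' (by rw [hc]; exact one_ne_zero)
    exact ⟨ts, h2, hs.sublist h1, fun t ht => ((hF t).mp (h1.subset ht)).2⟩
  · intro ts ts' h h'
    refine upPath_unique ?_ (hsub ts h) h.1 (hsub ts' h') h'.1
    rw [hc]
    split_ifs <;> simp

lemma existsUnique_upPath {K : Type} [LinearOrder K] {κ : W → K} (hκ : IsReflOrder cs κ)
    {x y : W} (h : ChainLE cs x y) :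
    ∃! ts, UpPath cs x ts y ∧ ts.Pairwise (fun a b => κ b < κ a) := by
  obtain ⟨ω, hω, rfl⟩ := cs.exists_isReduced y
  have h1 : ∀ t : W, ¬ cs.length (t * 1) < cs.length 1 := by simp
  obtain ⟨h2, h3⟩ := ordered_upPath hκ (b := 1) (fun _ _ _ h => absurd h (h1 _)) hω (x := x)
    (by simp)
  rw [mul_one, ← chainLE_wordProd_iff hω] at h2
  obtain ⟨ts, h4, h5, h6⟩ := h2.mpr h
  exact ⟨ts, ⟨h4, h5⟩, fun ts' h' => h3 _ _ ⟨h'.1, h'.2, fun _ _ => h1 _⟩ ⟨h4, h5, h6⟩⟩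

/-! ### First labels of ordered paths -/

/-- `ts` is the list of labels of a path of admissible moves from `y` to `x`. -/
def MovePath (ok : W → W → Prop) : W → List W → W → Prop
  | y, [], x => y = x
  | y, t :: ts, x => ok y t ∧ MovePath ok (y * t) ts x

/-- A system of moves with unique ordered paths and compatibility of the order of labels with
paths of length two. -/
structure OrderedMoves {K : Type} [LinearOrder K] (ok le : W → W → Prop) (κ : W → K)
    (rk : W → ℤ) : Prop where
  exists_unique : ∀ {x y}, le x y →
    ∃! ts, MovePath ok y ts x ∧ ts.Pairwise (fun a b => κ a < κ b)
  le_of_path : ∀ {x y ts}, MovePath ok y ts x → le x y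
  finite : ∀ x y, {t | ok y t ∧ le x (y * t)}.Finite
  rk_mul : ∀ {y t}, ok y t → rk (y * t) = rk y - 1
  ne_next : ∀ {y t r}, ok y t → ok (y * t) r → κ t ≠ κ r
  inj : ∀ {y t r}, ok y t → ok y r → κ t = κ r → t = r
  rank_two : ∀ {y t t' r r'}, ok y t → ok (y * t) t' → ok y r → ok (y * r) r' →
    y * t * t' = y * r * r' → κ t' < κ t → κ r < κ r' → κ r < κ t

/-- The labels of the increasing path from `y` to `x`. -/
noncomputable def incPath {K : Type} [LinearOrder K] (ok : W → W → Prop) (κ : W → K)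
    (x y : W) : List W :=
  if h : ∃ ts, MovePath ok y ts x ∧ ts.Pairwise (fun a b => κ a < κ b) then h.choose else []

/-- The first label of the increasing path from `y` to `x`. -/
noncomputable def firstLabel {K : Type} [LinearOrder K] (ok : W → W → Prop) (κ : W → K)
    (x y : W) : W := (incPath ok κ x y).headD 1

namespace OrderedMoves

variable {K : Type} [LinearOrder K] {ok le : W → W → Prop} {κ : W → K} {rk : W → ℤ}

lemma length_path (h : OrderedMoves ok le κ rk) {x y : W} {ts : List W}
    (hp : MovePath ok y ts x) : (ts.length : ℤ) = rk y - rk x := by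
  induction ts generalizing y with
  | nil => rw [MovePath] at hp; simp [hp]
  | cons t ts ih =>
    have := ih hp.2
    rw [h.rk_mul hp.1] at this
    push_cast [List.length_cons]
    omega

lemma incPath_spec (h : OrderedMoves ok le κ rk) {x y : W} (hxy : le x y) :
    MovePath ok y (incPath ok κ x y) x ∧ (incPath ok κ x y).Pairwise (fun a b => κ a < κ b) := by
  have := (h.exists_unique hxy).exists
  rw [incPath, dif_pos this]
  exact this.choose_spec

lemma eq_incPath (h : OrderedMoves ok le κ rk) {x y : W} {ts : List W}
    (hp : MovePath ok y ts x) (hs : ts.Pairwise (fun a b => κ a < κ b)) :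
    ts = incPath ok κ x y :=
  (h.exists_unique (h.le_of_path hp)).unique ⟨hp, hs⟩ (h.incPath_spec (h.le_of_path hp))

lemma incPath_eq_cons (h : OrderedMoves ok le κ rk) {x y : W} (hxy : le x y) (hne : y ≠ x) :
    ok y (firstLabel ok κ x y) ∧ le x (y * firstLabel ok κ x y) ∧
      incPath ok κ x y =
        firstLabel ok κ x y :: incPath ok κ x (y * firstLabel ok κ x y) := by
  obtain ⟨h1, h2⟩ := h.incPath_spec hxy
  rw [firstLabel]
  cases hc : incPath ok κ x y with
  | nil => rw [hc, MovePath] at h1; exact absurd h1 hne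
  | cons t ts =>
    rw [hc] at h1 h2
    refine ⟨h1.1, h.le_of_path h1.2, ?_⟩
    rw [List.headD_cons, ← h.eq_incPath h1.2 (List.pairwise_cons.mp h2).2]

lemma firstLabel_lt (h : OrderedMoves ok le κ rk) {x y : W} (hxy : le x y) (hne : y ≠ x)
    (hne' : y * firstLabel ok κ x y ≠ x) :
    κ (firstLabel ok κ x y) < κ (firstLabel ok κ x (y * firstLabel ok κ x y)) := by
  obtain ⟨_, h1, h2⟩ := h.incPath_eq_cons hxy hne
  obtain ⟨_, _, h3⟩ := h.incPath_eq_cons h1 hne'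
  have h4 := (h.incPath_spec hxy).2
  rw [h2, h3] at h4
  exact (List.pairwise_cons.mp h4).1 _ List.mem_cons_self

lemma cons_eq_incPath (h : OrderedMoves ok le κ rk) {x y t : W} (ht : ok y t)
    (hx : le x (y * t)) (hlt : y * t ≠ x → κ t < κ (firstLabel ok κ x (y * t))) :
    t :: incPath ok κ x (y * t) = incPath ok κ x y := by
  obtain ⟨h1, h2⟩ := h.incPath_spec hx
  refine h.eq_incPath (ts := t :: _) ⟨ht, h1⟩ (List.pairwise_cons.mpr ⟨fun r hr => ?_, h2⟩)
  by_cases hne : y * t = x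
  · have := h.length_path h1
    rw [hne, sub_self] at this
    have hnil := List.eq_nil_of_length_eq_zero (Int.natCast_eq_zero.mp this)
    rw [hne, hnil] at hr
    exact absurd hr List.not_mem_nil
  · have h3 := hlt hne
    rw [(h.incPath_eq_cons hx hne).2.2] at hr h2
    rcases List.mem_cons.mp hr with rfl | hr
    · exact h3
    · exact h3.trans ((List.pairwise_cons.mp h2).1 r hr)

lemma eq_firstLabel (h : OrderedMoves ok le κ rk) {x y t : W} (ht : ok y t)
    (hx : le x (y * t)) (hlt : y * t ≠ x → κ t < κ (firstLabel ok κ x (y * t))) :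
    t = firstLabel ok κ x y := by
  rw [firstLabel, ← h.cons_eq_incPath ht hx hlt, List.headD_cons]

lemma firstLabel_min (h : OrderedMoves ok le κ rk) {x y t : W}
    (ht : ok y t) (hx : le x (y * t)) (htn : t ≠ firstLabel ok κ x y) :
    κ (firstLabel ok κ x y) < κ t := by
  obtain ⟨t₀, ⟨h1, h2⟩, h3⟩ := Set.exists_min_image _ κ (h.finite x y) ⟨t, ht, hx⟩
  suffices t₀ = firstLabel ok κ x y by
    subst this
    exact lt_of_le_of_ne (h3 t ⟨ht, hx⟩) fun e => htn (h.inj h1 ht e).symm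
  refine h.eq_firstLabel h1 h2 fun hne' => ?_
  obtain ⟨h4, h5, _⟩ := h.incPath_eq_cons h2 hne'
  refine lt_of_le_of_ne (le_of_not_gt fun hlt => ?_) (h.ne_next h1 h4)
  set t' := firstLabel ok κ x (y * t₀)
  have hz : MovePath ok y [t₀, t'] (y * t₀ * t') := ⟨h1, h4, rfl⟩
  obtain ⟨h6, h7⟩ := h.incPath_spec (h.le_of_path hz)
  have hlen : (incPath ok κ (y * t₀ * t') y).length = 2 := by
    have := h.length_path h6
    rw [← h.length_path hz] at this
    exact_mod_cast this
  obtain ⟨r, r', hr⟩ := List.length_eq_two.mp hlen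
  rw [hr] at h6 h7
  obtain ⟨h8, h9, h10⟩ := h6
  rw [MovePath] at h10
  have hrr : κ r < κ r' := (List.pairwise_cons.mp h7).1 _ (by simp)
  have hpath : MovePath ok (y * r) (r' :: incPath ok κ x (y * t₀ * t')) x :=
    ⟨h9, by rw [h10]; exact (h.incPath_spec h5).1⟩
  exact not_lt_of_ge (h3 r ⟨h8, h.le_of_path hpath⟩)
    (h.rank_two h1 h4 h8 h9 h10.symm hlt hrr)

end OrderedMoves

variable (cs) in
/-- Downward Bruhat moves. -/
def downOk (y t : W) : Prop := cs.IsReflection t ∧ cs.length (y * t) + 1 = cs.length y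

variable (cs) in
/-- Upward Bruhat moves. -/
def upOk (y t : W) : Prop := cs.IsReflection t ∧ cs.length (y * t) = cs.length y + 1

lemma movePath_upOk {x y : W} {ts : List W} : MovePath (upOk cs) x ts y ↔ UpPath cs x ts y := by
  induction ts generalizing x with
  | nil => rfl
  | cons t ts ih => rw [MovePath, UpPath, ih, upOk, and_assoc]

lemma movePath_append {ok : W → W → Prop} {x y : W} {ts ts' : List W} :
    MovePath ok x (ts ++ ts') y ↔ ∃ z, MovePath ok x ts z ∧ MovePath ok z ts' y := by
  induction ts generalizing x with
  | nil => simp [MovePath]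
  | cons t ts ih =>
    rw [List.cons_append, MovePath, ih]
    simp only [MovePath, and_assoc, exists_and_left]

lemma movePath_downOk {x y : W} {ts : List W} :
    MovePath (downOk cs) y ts.reverse x ↔ UpPath cs x ts y := by
  induction ts generalizing x with
  | nil => simp [MovePath, UpPath, eq_comm]
  | cons t ts ih =>
    rw [List.reverse_cons, movePath_append, UpPath]
    simp only [ih, MovePath, downOk]
    constructor
    · rintro ⟨z, h1, ⟨h2, h3⟩, rfl⟩
      have : z * t * t = z := by rw [mul_assoc, h2.mul_self, mul_one]
      rw [this]
      exact ⟨h2, by omega, h1⟩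
    · rintro ⟨h1, h2, h3⟩
      have : x * t * t = x := by rw [mul_assoc, h1.mul_self, mul_one]
      exact ⟨x * t, h3, ⟨h1, by rw [this]; omega⟩, this⟩

lemma ne_of_length_mul_ne {y t r : W} (ht : cs.IsReflection t)
    (h : cs.length (y * t * r) ≠ cs.length y) : t ≠ r := by
  rintro rfl
  rw [mul_assoc, ht.mul_self, mul_one] at h
  exact h rfl

lemma orderedMoves_down {K : Type} [LinearOrder K] {κ : W → K} (hκ : IsReflOrder cs κ)
    (hr : RankTwo cs κ) :
    OrderedMoves (downOk cs) (ChainLE cs) κ (fun y => (cs.length y : ℤ)) where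
  exists_unique {x y} h := by
    obtain ⟨ts, ⟨h1, h2⟩, h3⟩ := existsUnique_upPath hκ h
    refine ⟨ts.reverse, ⟨movePath_downOk.mpr h1, List.pairwise_reverse.mpr h2⟩, ?_⟩
    rintro ts' ⟨h4, h5⟩
    rw [← List.reverse_reverse ts'] at h4 h5 ⊢
    rw [h3 ts'.reverse ⟨movePath_downOk.mp h4, List.pairwise_reverse.mp h5⟩]
  le_of_path {x y ts} h := by
    rw [← List.reverse_reverse ts] at h
    exact (movePath_downOk.mp h).chainLE
  finite x y := by
    refine ((finite_chainLE (cs := cs) y).image (y⁻¹ * ·)).subset ?_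
    rintro t ⟨⟨h1, h2⟩, _⟩
    have : y * t * t = y := by rw [mul_assoc, h1.mul_self, mul_one]
    refine ⟨y * t, ?_, by simp⟩
    have h3 := (bStep_mul (x := y * t) h1 (by rw [this]; omega)).chainLE
    rwa [this] at h3
  rk_mul {y t} h := by have := h.2; omega
  ne_next {y t r} h h' e :=
    ne_of_length_mul_ne (y := y) h.1 (by have := h.2; have := h'.2; omega) (hκ.inj h.1 h'.1 e)
  inj {y t r} h h' e := hκ.inj h.1 h'.1 e
  rank_two {y t t' r r'} h1 h2 h3 h4 e := by
    refine hr h1.1 h2.1 h3.1 h4.1 e (Or.inl ?_)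
    have := h1.2; have := h2.2; have := h3.2; have := h4.2
    omega

lemma orderedMoves_up {K : Type} [LinearOrder K] {κ : W → K} (hκ : IsReflOrder cs κ)
    (hr : RankTwo cs κ) :
    OrderedMoves (upOk cs) (fun x y => ChainLE cs y x) κ (fun y => -(cs.length y : ℤ)) where
  exists_unique {x y} h := by
    obtain ⟨ts, ⟨h1, h2⟩, h3⟩ := existsUnique_upPath hκ.dual h
    refine ⟨ts, ⟨movePath_upOk.mpr h1, h2.imp fun h => h⟩, ?_⟩
    rintro ts' ⟨h4, h5⟩
    exact h3 _ ⟨movePath_upOk.mp h4, h5.imp fun h => h⟩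
  le_of_path {x y ts} h := (movePath_upOk.mp h).chainLE
  finite x y := by
    refine ((finite_chainLE (cs := cs) x).image (y⁻¹ * ·)).subset ?_
    rintro t ⟨_, h⟩
    exact ⟨y * t, h, by simp⟩
  rk_mul {y t} h := by have := h.2; omega
  ne_next {y t r} h h' e :=
    ne_of_length_mul_ne (y := y) h.1 (by have := h.2; have := h'.2; omega) (hκ.inj h.1 h'.1 e)
  inj {y t r} h h' e := hκ.inj h.1 h'.1 e
  rank_two {y t t' r r'} h1 h2 h3 h4 e := by
    refine hr h1.1 h2.1 h3.1 h4.1 e (Or.inr ?_)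
    have := h1.2; have := h2.2; have := h3.2; have := h4.2
    omega

/-! ### A criterion for EL-labelings -/

lemma isChainFrom_cons_cons {α : Type} {r : α → α → Prop} {c : List α} {a b y z : α} :
    IsChainFrom r (y :: z :: c) a b ↔ y = a ∧ r a z ∧ IsChainFrom r (z :: c) z b := by
  simp only [IsChainFrom, List.head?_cons, Option.some.injEq, List.getLast?_cons_cons,
    List.Chain', List.isChain_cons_cons, true_and]
  constructor
  · rintro ⟨rfl, h1, h2, h3⟩; exact ⟨rfl, h2, h1, h3⟩
  · rintro ⟨rfl, h1, h2, h3⟩; exact ⟨rfl, h2, h1, h3⟩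

/-- A labeling is an EL-labeling if every interval has a distinguished coatom whose label is
strictly smallest and whose iteration gives the only chain without descents. -/
theorem isELOn_of_firstStep {α Λ : Type} {R cov : α → α → Prop} {lt : Λ → Λ → Prop}
    {lab : α → α → Λ} (ρ : α → ℕ) (m : α → α → α)
    (trans : ∀ {x y z}, R x y → R y z → R x z) (refl : ∀ {x y}, R x y → R x x ∧ R y y)
    (rank_le : ∀ {x y}, R x y → ρ x ≤ ρ y)
    (cov_le : ∀ {y z}, R y y → cov z y → R z y ∧ ρ z < ρ y)
    (cov_eq : ∀ {x y z}, R x y → cov x y → cov z y → R x z → z = x)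
    (step : ∀ {x y}, R x y → x ≠ y → cov (m x y) y ∧ R x (m x y) ∧
      (m x y ≠ x → lt (lab (m x y) y) (lab (m x (m x y)) (m x y))))
    (other : ∀ {x y z}, R x y → x ≠ y → cov z y → R x z → z ≠ m x y →
      lt (lab (m x y) y) (lab z y) ∧ (z ≠ x → ¬ lt (lab z y) (lab (m x z) z))) :
    IsELOn R cov lt lab := by
  have below : ∀ (c : List α) {x y : α}, R y y →
      IsChainFrom (fun a b => cov b a) (y :: c) y x → R x y := by
    intro c
    induction c with
    | nil =>
      intro x y hy h
      have : y = x := by simpa using h.2.1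
      rwa [← this]
    | cons z c ih =>
      intro x y hy h
      obtain ⟨_, h1, h2⟩ := isChainFrom_cons_cons.mp h
      have h3 := (cov_le hy h1).1
      exact trans (ih (refl h3).1 h2) h3
  have cases_chain : ∀ {c : List α} {x y : α}, R x y →
      IsChainFrom (fun a b => cov b a) c y x →
      (x = y ∧ c = [y]) ∨ ∃ z c', x ≠ y ∧ c = y :: z :: c' ∧ cov z y ∧ R x z ∧
        IsChainFrom (fun a b => cov b a) (z :: c') z x := by
    intro c x y hxy h
    match c, h with
    | [], h => exact absurd h.1 (by simp)
    | [a], h =>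
      have h1 : a = y := by simpa using h.1
      have h2 : a = x := by simpa using h.2.1
      exact Or.inl ⟨by rw [← h1, ← h2], by rw [h1]⟩
    | a :: z :: c', h =>
      obtain ⟨h1, h2, h3⟩ := isChainFrom_cons_cons.mp h
      have h4 := cov_le (refl hxy).2 h2
      have h5 := below c' (refl h4.1).1 h3
      refine Or.inr ⟨z, c', ?_, by rw [h1], h2, h5, h3⟩
      rintro rfl
      have := rank_le h5
      omega
  suffices key : ∀ (n : ℕ) (x y : α), ρ y = n → R x y → ∃ c : List α,
      (x ≠ y → ∃ c', c = y :: m x y :: c') ∧ (x = y → c = [y]) ∧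
      (IsChainFrom (fun a b => cov b a) c y x ∧ List.IsChain lt (labelWord lab c)) ∧
      (∀ c' : List α, IsChainFrom (fun a b => cov b a) c' y x ∧
          List.IsChain lt (labelWord lab c') → c' = c) ∧
      (∀ c' : List α, IsChainFrom (fun a b => cov b a) c' y x →
        List.Lex lt (labelWord lab c) (labelWord lab c') ∨
          labelWord lab c = labelWord lab c') by
    intro x y h
    obtain ⟨c, _, _, h1⟩ := key _ x y rfl h
    exact ⟨c, h1⟩
  intro n
  induction n using Nat.strong_induction_on with
  | _ n ih =>
    intro x y hn hxy
    subst hn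
    by_cases hne : x = y
    · subst hne
      refine ⟨[x], fun h => absurd rfl h, fun _ => rfl, ⟨⟨rfl, rfl, List.isChain_singleton _⟩,
        List.isChain_nil⟩, ?_, ?_⟩
      · rintro c' ⟨hc, _⟩
        rcases cases_chain hxy hc with ⟨_, h⟩ | ⟨z, c', h, _⟩
        · exact h
        · exact absurd rfl h
      · intro c' hc
        rcases cases_chain hxy hc with ⟨_, h⟩ | ⟨z, c', h, _⟩
        · rw [h]; exact Or.inr rfl
        · exact absurd rfl h
    obtain ⟨hm1, hm2, hm3⟩ := step hxy hne
    obtain ⟨c, c1, c2, ⟨c3, c3'⟩, c4, c5⟩ :=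
      ih _ (cov_le (refl hxy).2 hm1).2 x (m x y) rfl hm2
    obtain ⟨c₀, hc₀⟩ : ∃ c₀, c = m x y :: c₀ := by
      by_cases h : x = m x y
      · exact ⟨_, c2 h⟩
      · obtain ⟨c', h⟩ := c1 h; exact ⟨_, h⟩
    subst hc₀
    refine ⟨y :: m x y :: c₀, fun _ => ⟨_, rfl⟩, fun h => absurd h hne,
      ⟨isChainFrom_cons_cons.mpr ⟨rfl, hm1, c3⟩, ?_⟩, ?_, ?_⟩
    · rw [labelWord]
      by_cases h : x = m x y
      · rw [c2 h]
        exact List.isChain_singleton _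
      · obtain ⟨c', hc'⟩ := c1 h
        rw [hc'] at c3' ⊢
        rw [labelWord] at c3' ⊢
        exact List.isChain_cons_cons.mpr ⟨hm3 (Ne.symm h), c3'⟩
    · rintro c' ⟨h1, h2⟩
      rcases cases_chain hxy h1 with ⟨h, _⟩ | ⟨z, c', _, rfl, h3, h4, h5⟩
      · exact absurd h hne
      obtain ⟨d, d1, d2, ⟨d3, d3'⟩, d4, d5⟩ := ih _ (cov_le (refl hxy).2 h3).2 x z rfl h4
      rw [labelWord] at h2
      have h6 := d4 _ ⟨h5, h2.tail⟩
      by_cases hz : z = m x y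
      · subst hz
        rw [c4 _ ⟨h5, h2.tail⟩]
      · exfalso
        have h7 := other hxy hne h3 h4 hz
        by_cases hzx : z = x
        · subst hzx
          exact hz (cov_eq hxy h3 hm1 hm2).symm
        · obtain ⟨d', hd⟩ := d1 (Ne.symm hzx)
          rw [h6, hd, labelWord] at h2
          exact h7.2 hzx (List.isChain_cons_cons.mp h2).1
    · intro c' h1
      rcases cases_chain hxy h1 with ⟨h, _⟩ | ⟨z, c', _, rfl, h3, h4, h5⟩
      · exact absurd h hne
      rw [labelWord, labelWord]
      by_cases hz : z = m x y
      · subst hz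
        rcases c5 _ h5 with h | h
        · exact Or.inl (List.Lex.cons h)
        · exact Or.inr (by rw [h])
      · exact Or.inl (List.Lex.rel (other hxy hne h3 h4 hz).1)

/-! ### The downward Demazure product -/

variable (cs) in
/-- The downward Demazure product of `a⁻¹` and `v`. -/
noncomputable def demazure (a v : W) : W := greedy cs (cs.exists_isReduced a).choose v

lemma demazure_spec (a v : W) :
    ChainLE cs (v * (demazure cs a v)⁻¹) a ∧
      cs.length v = cs.length (v * (demazure cs a v)⁻¹) + cs.length (demazure cs a v) := by
  obtain ⟨h1, h2⟩ := (cs.exists_isReduced a).choose_spec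
  obtain ⟨ω', h3, h4, h5⟩ := exists_sublist_greedy (cs := cs) (cs.exists_isReduced a).choose v
  have h6 : v * (demazure cs a v)⁻¹ = cs.wordProd ω' := by
    rw [mul_inv_eq_iff_eq_mul]; exact h4
  rw [h6]
  refine ⟨?_, h5⟩
  have := chainLE_of_sublist h1 h3
  rwa [← h2] at this

lemma greedy_le_of_sublist {ω ω' : List B} (h : ω'.Sublist ω) (v : W) :
    ChainLE cs (greedy cs ω v) ((cs.wordProd ω')⁻¹ * v) := by
  induction h generalizing v with
  | slnil => simpa [greedy] using ChainLE.refl (cs := cs) v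
  | cons i h ih => exact ((smin_le i v).greedy _).trans (ih v)
  | cons_cons i h ih =>
    rw [cs.wordProd_cons, mul_inv_rev, cs.inv_simple, mul_assoc, greedy]
    refine ChainLE.trans (ChainLE.greedy ?_ _) (ih _)
    rcases simple_lt_or_gt (cs := cs) i v with h | h
    · rw [smin_of_lt h]; exact .refl _
    · rw [smin_of_gt h]; exact (bStep_simple h).chainLE

lemma demazure_le {a c v : W} (h : ChainLE cs c a) :
    ChainLE cs (demazure cs a v) (c⁻¹ * v) := by
  obtain ⟨h1, h2⟩ := (cs.exists_isReduced a).choose_spec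
  rw [h2] at h
  obtain ⟨ω', h3, h4⟩ := ChainLE.exists_sublist h1 h
  rw [← h4]
  exact greedy_le_of_sublist h3 v

lemma demazure_anti {a a' : W} (h : ChainLE cs a' a) (v : W) :
    ChainLE cs (demazure cs a v) (demazure cs a' v) := by
  have := demazure_le (v := v) ((demazure_spec (cs := cs) a' v).1.trans h)
  simpa using this

lemma demazure_mono (a : W) {v v' : W} (h : ChainLE cs v v') :
    ChainLE cs (demazure cs a v) (demazure cs a v') := h.greedy _

/-- The downward Demazure product in terms of ordered paths. -/
lemma demazure_eq_iff {K : Type} [LinearOrder K] {κ : W → K} (hκ : IsReflOrder cs κ)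
    (hr : RankTwo cs κ) {b : W} (hN : InvFinal cs κ b) {a x : W} (hxa : ChainLE cs x a)
    (hx : cs.length (x * b) = cs.length x + cs.length b) :
    demazure cs a (x * b) = b ↔
      ∀ t ∈ incPath (downOk cs) κ x a, ¬ cs.length (t * b) < cs.length b := by
  obtain ⟨h1, h2⟩ := (cs.exists_isReduced a).choose_spec
  have hO := orderedMoves_down hκ hr
  obtain ⟨h3, h4⟩ := hO.incPath_spec hxa
  rw [demazure, ← (ordered_upPath hκ hN h1 hx).1, ← h2]
  constructor
  · rintro ⟨ts, h5, h6, h7⟩ t ht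
    rw [← hO.eq_incPath (movePath_downOk.mpr h5) (List.pairwise_reverse.mpr h6)] at ht
    exact h7 t (List.mem_reverse.mp ht)
  · intro h
    refine ⟨(incPath (downOk cs) κ x a).reverse, movePath_downOk.mp (by simpa using h3),
      List.pairwise_reverse.mpr h4, fun t ht => h t (List.mem_reverse.mp ht)⟩

/-! ### The poset of triples -/

/-- The triple with first entry `a⁻¹`. -/
def trip (a v u : W) : Option (W × W × W) := some (a⁻¹, v, u)

lemma eq_none_or_trip (x : Option (W × W × W)) : x = none ∨ ∃ a v u, x = trip a v u := by
  match x with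
  | none => exact Or.inl rfl
  | some (w, v, u) => exact Or.inr ⟨w⁻¹, v, u, by rw [trip, inv_inv]⟩

lemma trip_inj {a v u a' v' u' : W} : trip a v u = trip a' v' u' ↔ a = a' ∧ v = v' ∧ u = u' := by
  simp [trip]

lemma hle_trip {a v u a' v' u' : W} : hle cs (trip a v u) (trip a' v' u') ↔
    ChainLE cs a a' ∧ ChainLE cs v' v ∧ ChainLE cs u u' := by
  simp only [trip, hle, qqle, bruhatLE_iff, chainLE_inv_iff]

lemma hvalid_trip {a v u : W} : hvalid cs (trip a v u) ↔ ChainLE cs (demazure cs a v) u := by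
  simp only [trip, hvalid, Qmem, bruhatLE_iff]
  constructor
  · rintro ⟨w, h1, h2⟩
    have := demazure_le (v := v) (by simpa using h1.inv)
    rw [inv_inv] at this
    exact this.trans h2
  · intro h
    refine ⟨(v * (demazure cs a v)⁻¹)⁻¹, (demazure_spec a v).1.inv, ?_⟩
    simpa using h

lemma hle_refl (x : Option (W × W × W)) : hle cs x x := by
  rcases eq_none_or_trip x with rfl | ⟨a, v, u, rfl⟩
  · trivial
  · exact hle_trip.mpr ⟨.refl _, .refl _, .refl _⟩

lemma hle_none {x : Option (W × W × W)} (h : hle cs x none) : x = none := by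
  match x, h with
  | none, _ => rfl

lemma hle_trans {x y z : Option (W × W × W)} (h : hle cs x y) (h' : hle cs y z) :
    hle cs x z := by
  rcases eq_none_or_trip x with rfl | ⟨a, v, u, rfl⟩
  · trivial
  rcases eq_none_or_trip y with rfl | ⟨a, v, u, rfl⟩
  · exact absurd (hle_none h) (by simp [trip])
  rcases eq_none_or_trip z with rfl | ⟨a, v, u, rfl⟩
  · exact absurd (hle_none h') (by simp [trip])
  rw [hle_trip] at *
  exact ⟨h.1.trans h'.1, h'.2.1.trans h.2.1, h.2.2.trans h'.2.2⟩

lemma hvalid_of_hle {a v u : W} {y : Option (W × W × W)} (h : hvalid cs (trip a v u))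
    (h' : hle cs (trip a v u) y) : hvalid cs y := by
  rcases eq_none_or_trip y with rfl | ⟨a', v', u', rfl⟩
  · trivial
  rw [hle_trip] at h'
  rw [hvalid_trip] at *
  exact ((demazure_mono a' h'.2.1).trans (demazure_anti h'.1 v)).trans (h.trans h'.2.2)

lemma length_le_of_hvalid {a v u : W} (h : hvalid cs (trip a v u)) :
    cs.length v ≤ cs.length a + cs.length u := by
  obtain ⟨h1, h2⟩ := demazure_spec (cs := cs) a v
  have := h1.length_le
  have := (hvalid_trip.mp h).length_le
  omega

variable (cs) in
/-- The rank function on the augmented poset of triples. -/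
noncomputable def rankQ : Option (W × W × W) → ℕ
  | none => 0
  | some y => cs.length y.1 + cs.length y.2.2 - cs.length y.2.1 + 1

lemma rankQ_trip (a v u : W) :
    rankQ cs (trip a v u) = cs.length a + cs.length u - cs.length v + 1 := by
  simp [trip, rankQ, cs.length_inv]

lemma rankQ_lt {x y : Option (W × W × W)} (hx : hvalid cs x) (hy : hvalid cs y)
    (h : hlt cs x y) : rankQ cs x < rankQ cs y := by
  rcases eq_none_or_trip y with rfl | ⟨a, v, u, rfl⟩
  · exact absurd (hle_none h.1) h.2
  rw [rankQ_trip]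
  rcases eq_none_or_trip x with rfl | ⟨a', v', u', rfl⟩
  · simp [rankQ]
  obtain ⟨h, hne⟩ := h
  rw [hle_trip] at h
  rw [rankQ_trip]
  have hl := length_le_of_hvalid hx
  have hl' := length_le_of_hvalid hy
  have h1 := h.1.length_le
  have h2 := h.2.1.length_le
  have h3 := h.2.2.length_le
  by_cases e1 : a' = a
  · by_cases e3 : u' = u
    · by_cases e2 : v = v'
      · exact absurd (trip_inj.mpr ⟨e1, e2.symm, e3⟩) hne
      · have := h.2.1.length_lt e2
        omega
    · have := h.2.2.length_lt e3
      omega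
  · have := h.1.length_lt e1
    omega

lemma hcov_of_rankQ {x y : Option (W × W × W)} (hx : hvalid cs x) (hy : hvalid cs y)
    (h : hle cs x y) (hr : rankQ cs y = rankQ cs x + 1) : hcov cs x y := by
  refine ⟨hx, hy, ⟨h, ?_⟩, ?_⟩
  · rintro rfl; omega
  · rintro ⟨z, h1, h2, h3⟩
    have := rankQ_lt hx h1 h2
    have := rankQ_lt h1 hy h3
    omega

lemma chainLE_of_downOk {y t : W} (h : downOk cs y t) : ChainLE cs (y * t) y := by
  have e : y * t * t = y := by rw [mul_assoc, h.1.mul_self, mul_one]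
  have := (bStep_mul (x := y * t) h.1 (by rw [e]; exact h.2.symm)).chainLE
  rwa [e] at this

lemma chainLE_of_upOk {y t : W} (h : upOk cs y t) : ChainLE cs y (y * t) :=
  (bStep_mul h.1 h.2).chainLE

lemma hcov_down_right {a v u t : W} (h : hvalid cs (trip a v (u * t))) (ht : downOk cs u t) :
    hcov cs (trip a v (u * t)) (trip a v u) := by
  have hle : hle cs (trip a v (u * t)) (trip a v u) :=
    hle_trip.mpr ⟨.refl _, .refl _, chainLE_of_downOk ht⟩
  refine hcov_of_rankQ h (hvalid_of_hle h hle) hle ?_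
  have := length_le_of_hvalid h
  have := ht.2
  rw [rankQ_trip, rankQ_trip]
  omega

lemma hcov_down_left {a v u t : W} (h : hvalid cs (trip (a * t) v u)) (ht : downOk cs a t) :
    hcov cs (trip (a * t) v u) (trip a v u) := by
  have hle : hle cs (trip (a * t) v u) (trip a v u) :=
    hle_trip.mpr ⟨chainLE_of_downOk ht, .refl _, .refl _⟩
  refine hcov_of_rankQ h (hvalid_of_hle h hle) hle ?_
  have := length_le_of_hvalid h
  have := ht.2
  rw [rankQ_trip, rankQ_trip]
  omega

lemma hcov_up {a v u t : W} (h : hvalid cs (trip a (v * t) u)) (ht : upOk cs v t) :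
    hcov cs (trip a (v * t) u) (trip a v u) := by
  have hle : hle cs (trip a (v * t) u) (trip a v u) :=
    hle_trip.mpr ⟨.refl _, chainLE_of_upOk ht, .refl _⟩
  refine hcov_of_rankQ h (hvalid_of_hle h hle) hle ?_
  have := length_le_of_hvalid h
  have := ht.2
  rw [rankQ_trip, rankQ_trip]
  omega

lemma eq_of_hcov {x y z : Option (W × W × W)} (h : hcov cs x y) (hz : hvalid cs z)
    (hxz : hle cs x z) (hzy : hlt cs z y) : z = x := by
  by_contra hne
  exact h.2.2.2 ⟨z, hz, ⟨hxz, Ne.symm hne⟩, hzy⟩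

lemma exists_downOk_of_chainLE {x y : W} (h : ChainLE cs x y) (hne : x ≠ y) :
    ∃ t, downOk cs y t ∧ ChainLE cs x (y * t) := by
  obtain ⟨z, h1, t, h2, rfl, h3⟩ := h.exists_step' hne
  have e : z * t * t = z := by rw [mul_assoc, h2.mul_self, mul_one]
  exact ⟨t, ⟨h2, by rw [e]; exact h3.symm⟩, by rwa [e]⟩

/-- The three kinds of covering relations between triples. -/
lemma hcov_trip {a v u : W} {z : Option (W × W × W)} (hz : z ≠ none)
    (h : hcov cs z (trip a v u)) :
    (∃ t, downOk cs u t ∧ z = trip a v (u * t)) ∨ (∃ t, downOk cs a t ∧ z = trip (a * t) v u) ∨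
      ∃ t, upOk cs v t ∧ z = trip a (v * t) u := by
  rcases eq_none_or_trip z with rfl | ⟨a', v', u', rfl⟩
  · exact absurd rfl hz
  have hle := h.2.2.1.1
  have hne := h.2.2.1.2
  rw [hle_trip] at hle
  obtain ⟨h1, h2, h3⟩ := hle
  by_cases e3 : u' = u
  · by_cases e1 : a' = a
    · by_cases e2 : v = v'
      · exact absurd (trip_inj.mpr ⟨e1, e2.symm, e3⟩) hne
      · obtain ⟨_, ⟨t, ht, rfl, htl⟩, h5⟩ := h2.exists_step e2
        have h6 : TwistedTP.hle cs (trip a' v' u') (trip a (v * t) u) :=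
          hle_trip.mpr ⟨h1, h5, h3⟩
        have h7 := hvalid_of_hle h.1 h6
        exact Or.inr (Or.inr ⟨t, ⟨ht, htl⟩, (eq_of_hcov h h7 h6 (hcov_up h7 ⟨ht, htl⟩).2.2.1).symm⟩)
    · obtain ⟨t, ht, h5⟩ := exists_downOk_of_chainLE h1 e1
      have h6 : TwistedTP.hle cs (trip a' v' u') (trip (a * t) v u) := hle_trip.mpr ⟨h5, h2, h3⟩
      have h7 := hvalid_of_hle h.1 h6
      exact Or.inr (Or.inl ⟨t, ht, (eq_of_hcov h h7 h6 (hcov_down_left h7 ht).2.2.1).symm⟩)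
  · obtain ⟨t, ht, h5⟩ := exists_downOk_of_chainLE h3 e3
    have h6 : TwistedTP.hle cs (trip a' v' u') (trip a v (u * t)) := hle_trip.mpr ⟨h1, h2, h5⟩
    have h7 := hvalid_of_hle h.1 h6
    exact Or.inl ⟨t, ht, (eq_of_hcov h h7 h6 (hcov_down_right h7 ht).2.2.1).symm⟩

section Labels

/-! ### The labeling -/

variable {K : Type}

/-- The label of a covering relation changing the third entry. -/
def rightLab (κ : W → W → K) (t : W) : ℕ ×ₗ K := toLex (0, κ 1 t)

variable (cs) in
/-- The label of a covering relation changing the first entry. -/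
noncomputable def leftLab (κ : W → W → K) (b t : W) : ℕ ×ₗ K :=
  toLex (if cs.length (t * b) < cs.length b then 3 else 1, κ b t)

/-- The label of a covering relation with the minimum. -/
def botLab (κ : W → W → K) : ℕ ×ₗ K := toLex (2, κ 1 1)

/-- The label of a covering relation changing the second entry. -/
def midLab (κ : W → W → K) (t : W) : ℕ ×ₗ K := toLex (4, κ 1 t)

variable (cs) in
/-- The edge labeling of the augmented poset of triples. -/
noncomputable def labQ (κ : W → W → K) : Option (W × W × W) → Option (W × W × W) → ℕ ×ₗ K
  | some (w', v', u'), some (w, v, u) =>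
    if u' ≠ u then rightLab κ (u⁻¹ * u') else
    if w' ≠ w then leftLab cs κ u (w * w'⁻¹) else midLab κ (v⁻¹ * v')
  | _, _ => botLab κ

lemma mul_ne_of_isReflection {x t : W} (ht : cs.IsReflection t) : x * t ≠ x := by
  intro h
  have h1 : t = 1 := mul_eq_left.mp h
  have := ht.odd_length
  rw [h1, cs.length_one] at this
  exact absurd this (by decide)

lemma labQ_right (κ : W → W → K) {a v u t : W} (ht : cs.IsReflection t) :
    labQ cs κ (trip a v (u * t)) (trip a v u) = rightLab κ t := by
  simp only [trip, labQ]
  rw [if_pos (mul_ne_of_isReflection ht), inv_mul_cancel_left]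

lemma labQ_left (κ : W → W → K) {a v u t : W} (ht : cs.IsReflection t) :
    labQ cs κ (trip (a * t) v u) (trip a v u) = leftLab cs κ u t := by
  simp only [trip, labQ]
  rw [if_neg (by simp), if_pos (fun h => mul_ne_of_isReflection ht (inv_injective h)), inv_inv,
    inv_mul_cancel_left]

lemma labQ_mid (κ : W → W → K) (a v u t : W) :
    labQ cs κ (trip a (v * t) u) (trip a v u) = midLab κ t := by
  simp [trip, labQ]

lemma labQ_none (κ : W → W → K) (y : Option (W × W × W)) : labQ cs κ none y = botLab κ := by
  simp [labQ]

variable [LinearOrder K]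

variable (cs) in
/-- The coatom of `[x, y]` on the increasing chain. -/
noncomputable def stepQ (κ : W → W → K) :
    Option (W × W × W) → Option (W × W × W) → Option (W × W × W)
  | some (w', v', u'), some (w, v, u) =>
    if u ≠ u' then trip w⁻¹ v (u * firstLabel (downOk cs) (κ 1) u' u) else
    if w⁻¹ ≠ w'⁻¹ then trip (w⁻¹ * firstLabel (downOk cs) (κ u) w'⁻¹ w⁻¹) v u else
      trip w⁻¹ (v * firstLabel (upOk cs) (κ 1) v' v) u
  | none, some (w, v, u) =>
    if u ≠ demazure cs w⁻¹ v then
      trip w⁻¹ v (u * firstLabel (downOk cs) (κ 1) (demazure cs w⁻¹ v) u) else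
    if w⁻¹ ≠ v * u⁻¹ then trip (w⁻¹ * firstLabel (downOk cs) (κ u) (v * u⁻¹) w⁻¹) v u else none
  | _, none => none

lemma rightLab_lt_rightLab {κ : W → W → K} {s t : W} :
    rightLab κ s < rightLab κ t ↔ κ 1 s < κ 1 t := by
  simp [rightLab, Prod.Lex.toLex_lt_toLex]

lemma midLab_lt_midLab {κ : W → W → K} {s t : W} :
    midLab κ s < midLab κ t ↔ κ 1 s < κ 1 t := by
  simp [midLab, Prod.Lex.toLex_lt_toLex]

lemma rightLab_lt_leftLab (κ : W → W → K) (s b t : W) : rightLab κ s < leftLab cs κ b t := by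
  rw [rightLab, leftLab, Prod.Lex.toLex_lt_toLex]
  refine Or.inl ?_
  dsimp only
  split_ifs <;> omega

lemma rightLab_lt_botLab (κ : W → W → K) (s : W) : rightLab κ s < botLab κ := by
  simp [rightLab, botLab, Prod.Lex.toLex_lt_toLex]

lemma rightLab_lt_midLab (κ : W → W → K) (s t : W) : rightLab κ s < midLab κ t := by
  simp [rightLab, midLab, Prod.Lex.toLex_lt_toLex]

lemma leftLab_lt_midLab (κ : W → W → K) (s b t : W) : leftLab cs κ b t < midLab κ s := by
  rw [midLab, leftLab, Prod.Lex.toLex_lt_toLex]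
  refine Or.inl ?_
  dsimp only
  split_ifs <;> omega

lemma botLab_lt_midLab (κ : W → W → K) (s : W) : botLab κ < midLab κ s := by
  simp [botLab, midLab, Prod.Lex.toLex_lt_toLex]

lemma leftLab_lt_botLab {κ : W → W → K} {b t : W} :
    leftLab cs κ b t < botLab κ ↔ ¬ cs.length (t * b) < cs.length b := by
  rw [botLab, leftLab, Prod.Lex.toLex_lt_toLex]
  dsimp only
  split_ifs with h <;> simp [h]

lemma leftLab_lt_leftLab {κ : W → W → K} {b s t : W} (hκ : IsReflOrder cs (κ b))
    (hN : InvFinal cs (κ b) b) (hs : cs.IsReflection s) (ht : cs.IsReflection t) :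
    leftLab cs κ b s < leftLab cs κ b t ↔ κ b s < κ b t := by
  rw [leftLab, leftLab, Prod.Lex.toLex_lt_toLex]
  dsimp only
  have h1 : κ b s < κ b t → cs.length (s * b) < cs.length b → cs.length (t * b) < cs.length b :=
    fun h => hN hs ht h
  have h2 : κ b t < κ b s → cs.length (t * b) < cs.length b → cs.length (s * b) < cs.length b :=
    fun h => hN ht hs h
  rcases lt_trichotomy (κ b s) (κ b t) with h | h | h
  · split_ifs <;> simp_all
  · have := hκ.inj hs ht h
    subst this
    simp
  · have := not_lt_of_gt h
    split_ifs <;> simp_all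

lemma stepQ_right (κ : W → W → K) {a' v' u' a v u : W} (h : u ≠ u') :
    stepQ cs κ (trip a' v' u') (trip a v u) =
      trip a v (u * firstLabel (downOk cs) (κ 1) u' u) := by
  simp only [trip, stepQ]
  rw [if_pos h, inv_inv]

lemma stepQ_left (κ : W → W → K) {a' v' a v u : W} (h : a ≠ a') :
    stepQ cs κ (trip a' v' u) (trip a v u) =
      trip (a * firstLabel (downOk cs) (κ u) a' a) v u := by
  simp only [trip, stepQ, inv_inv]
  rw [if_neg (by simp), if_pos h]

lemma stepQ_mid (κ : W → W → K) (v' a v u : W) :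
    stepQ cs κ (trip a v' u) (trip a v u) =
      trip a (v * firstLabel (upOk cs) (κ 1) v' v) u := by
  simp [trip, stepQ]

lemma stepQ_none_right (κ : W → W → K) {a v u : W} (h : u ≠ demazure cs a v) :
    stepQ cs κ none (trip a v u) =
      trip a v (u * firstLabel (downOk cs) (κ 1) (demazure cs a v) u) := by
  simp only [trip, stepQ, inv_inv]
  rw [if_pos h]

lemma stepQ_none_left (κ : W → W → K) {a v u : W} (h : u = demazure cs a v)
    (h' : a ≠ v * u⁻¹) : stepQ cs κ none (trip a v u) =
      trip (a * firstLabel (downOk cs) (κ u) (v * u⁻¹) a) v u := by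
  simp only [trip, stepQ, inv_inv]
  rw [if_neg (not_not.mpr h), if_pos h']

lemma stepQ_none_bot (κ : W → W → K) {a v u : W} (h : u = demazure cs a v)
    (h' : a = v * u⁻¹) : stepQ cs κ none (trip a v u) = none := by
  simp only [trip, stepQ, inv_inv]
  rw [if_neg (not_not.mpr h), if_neg (not_not.mpr h')]

variable {κ : W → W → K}

variable (cs) in
/-- A family of reflection orders indexed by group elements, where the left inversions of `b`
are final for the order attached to `b`. -/
def AdaptedOrders (κ : W → W → K) : Prop :=
  ∀ b, IsReflOrder cs (κ b) ∧ RankTwo cs (κ b) ∧ InvFinal cs (κ b) b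

lemma AdaptedOrders.down (hκ : AdaptedOrders cs κ) (b : W) :
    OrderedMoves (downOk cs) (ChainLE cs) (κ b) (fun y => (cs.length y : ℤ)) :=
  orderedMoves_down (hκ b).1 (hκ b).2.1

lemma AdaptedOrders.up (hκ : AdaptedOrders cs κ) (b : W) :
    OrderedMoves (upOk cs) (fun x y => ChainLE cs y x) (κ b) (fun y => -(cs.length y : ℤ)) :=
  orderedMoves_up (hκ b).1 (hκ b).2.1

/-- The label of the first step when the third entries differ. -/
lemma next_right (hκ : AdaptedOrders cs κ) {a' v' u' a v u : W} (h : u ≠ u')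
    (hle : ChainLE cs u' u) :
    labQ cs κ (stepQ cs κ (trip a' v' u') (trip a v u)) (trip a v u) =
      rightLab κ (firstLabel (downOk cs) (κ 1) u' u) := by
  rw [stepQ_right κ h, labQ_right κ ((hκ.down 1).incPath_eq_cons hle h).1.1]

lemma next_left (hκ : AdaptedOrders cs κ) {a' v' a v u : W} (h : a ≠ a')
    (hle : ChainLE cs a' a) :
    labQ cs κ (stepQ cs κ (trip a' v' u) (trip a v u)) (trip a v u) =
      leftLab cs κ u (firstLabel (downOk cs) (κ u) a' a) := by
  rw [stepQ_left κ h, labQ_left κ ((hκ.down u).incPath_eq_cons hle h).1.1]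

lemma next_mid (v' a v u : W) :
    labQ cs κ (stepQ cs κ (trip a v' u) (trip a v u)) (trip a v u) =
      midLab κ (firstLabel (upOk cs) (κ 1) v' v) := by
  rw [stepQ_mid κ, labQ_mid]

lemma next_none_right (hκ : AdaptedOrders cs κ) {a v u : W} (hv : hvalid cs (trip a v u))
    (h : u ≠ demazure cs a v) :
    labQ cs κ (stepQ cs κ none (trip a v u)) (trip a v u) =
      rightLab κ (firstLabel (downOk cs) (κ 1) (demazure cs a v) u) := by
  rw [stepQ_none_right κ h,
    labQ_right κ ((hκ.down 1).incPath_eq_cons (hvalid_trip.mp hv) h).1.1]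

lemma le_of_eq_demazure {a v u : W} (h : u = demazure cs a v) : ChainLE cs (v * u⁻¹) a := by
  rw [h]; exact (demazure_spec a v).1

lemma next_none_left (hκ : AdaptedOrders cs κ) {a v u : W}
    (h : u = demazure cs a v) (h' : a ≠ v * u⁻¹) :
    labQ cs κ (stepQ cs κ none (trip a v u)) (trip a v u) =
      leftLab cs κ u (firstLabel (downOk cs) (κ u) (v * u⁻¹) a) := by
  rw [stepQ_none_left κ h h',
    labQ_left κ ((hκ.down u).incPath_eq_cons (le_of_eq_demazure h) h').1.1]

lemma next_none_bot {a v u : W} (h : u = demazure cs a v) (h' : a = v * u⁻¹) :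
    labQ cs κ (stepQ cs κ none (trip a v u)) (trip a v u) = botLab κ := by
  rw [stepQ_none_bot κ h h', labQ_none]

lemma rightLab_lt_next (hκ : AdaptedOrders cs κ) {a v u : W} (s : W) (h : u = demazure cs a v) :
    rightLab κ s < labQ cs κ (stepQ cs κ none (trip a v u)) (trip a v u) := by
  by_cases h' : a = v * u⁻¹
  · rw [next_none_bot h h']; exact rightLab_lt_botLab κ s
  · rw [next_none_left hκ h h']; exact rightLab_lt_leftLab κ s _ _

lemma next_none_lt_midLab (hκ : AdaptedOrders cs κ) {a v u : W} (hv : hvalid cs (trip a v u))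
    (s : W) : labQ cs κ (stepQ cs κ none (trip a v u)) (trip a v u) < midLab κ s := by
  by_cases h : u = demazure cs a v
  · by_cases h' : a = v * u⁻¹
    · rw [next_none_bot h h']; exact botLab_lt_midLab κ s
    · rw [next_none_left hκ h h']; exact leftLab_lt_midLab κ s _ _
  · rw [next_none_right hκ hv h]; exact rightLab_lt_midLab κ _ _

lemma length_eq_of_eq_demazure {a v u : W} (h : u = demazure cs a v) :
    cs.length v = cs.length (v * u⁻¹) + cs.length u := by
  rw [h]; exact (demazure_spec a v).2

/-- The increasing path below a triple with minimal third entry avoids the inversions of that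
entry, and conversely. -/
lemma eq_demazure_iff (hκ : AdaptedOrders cs κ) {a v u : W} (hle : ChainLE cs (v * u⁻¹) a)
    (hl : cs.length v = cs.length (v * u⁻¹) + cs.length u) :
    u = demazure cs a v ↔
      ∀ t ∈ incPath (downOk cs) (κ u) (v * u⁻¹) a, ¬ cs.length (t * u) < cs.length u := by
  have := demazure_eq_iff (hκ u).1 (hκ u).2.1 (hκ u).2.2 hle (by simpa using hl)
  rw [inv_mul_cancel_right] at this
  rw [← this, eq_comm]

lemma firstLabel_mem_incPath (hκ : AdaptedOrders cs κ) {b x a : W} (hle : ChainLE cs x a)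
    (hne : a ≠ x) : firstLabel (downOk cs) (κ b) x a ∈ incPath (downOk cs) (κ b) x a := by
  rw [((hκ.down b).incPath_eq_cons hle hne).2.2]
  exact List.mem_cons_self

/-- If multiplying the first entry makes the third entry minimal, the chain has a descent. -/
lemma not_leftLab_lt_next (hκ : AdaptedOrders cs κ) {a v u t : W} (ht : downOk cs a t)
    (h : u ≠ demazure cs a v) (h' : u = demazure cs (a * t) v) :
    ¬ leftLab cs κ u t <
      labQ cs κ (stepQ cs κ none (trip (a * t) v u)) (trip (a * t) v u) := by
  intro hlt
  have hle := le_of_eq_demazure h'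
  have hl := length_eq_of_eq_demazure h'
  have hmem := (eq_demazure_iff hκ hle hl).mp h'
  refine h ((eq_demazure_iff hκ (hle.trans (chainLE_of_downOk ht)) hl).mpr ?_)
  suffices H : ¬ cs.length (t * u) < cs.length u ∧
      (a * t ≠ v * u⁻¹ → κ u t < κ u (firstLabel (downOk cs) (κ u) (v * u⁻¹) (a * t))) by
    rw [← (hκ.down u).cons_eq_incPath ht hle H.2]
    intro r hr
    rcases List.mem_cons.mp hr with rfl | hr
    · exact H.1
    · exact hmem r hr
  by_cases h3 : a * t = v * u⁻¹
  · rw [next_none_bot h' h3, leftLab_lt_botLab] at hlt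
    exact ⟨hlt, fun h => absurd h3 h⟩
  · have h4 := ((hκ.down u).incPath_eq_cons hle h3).1.1
    rw [next_none_left hκ h' h3] at hlt
    have h5 := hlt.trans (leftLab_lt_botLab.mpr (hmem _ (firstLabel_mem_incPath hκ hle h3)))
    rw [leftLab_lt_leftLab (hκ u).1 (hκ u).2.2 ht.1 h4] at hlt
    exact ⟨leftLab_lt_botLab.mp h5, fun _ => hlt⟩

lemma eq_demazure_of_le {a v u a' : W} (h : u = demazure cs a v) (hle : ChainLE cs a' a)
    (hv : hvalid cs (trip a' v u)) : u = demazure cs a' v := by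
  have h1 := demazure_anti hle v
  rw [← h] at h1
  exact h1.antisymm (hvalid_trip.mp hv)

lemma hvalid_of_mul_inv_le {a v u : W} (h : ChainLE cs (v * u⁻¹) a) :
    hvalid cs (trip a v u) := by
  rw [hvalid_trip]
  simpa using demazure_le (v := v) h

/-- The distinguished coatom lies on an increasing chain. -/
lemma stepQ_spec (hκ : AdaptedOrders cs κ) {x y : Option (W × W × W)} (hx : hvalid cs x)
    (hy : hvalid cs y) (hxy : hle cs x y) (hne : x ≠ y) :
    hcov cs (stepQ cs κ x y) y ∧ hle cs x (stepQ cs κ x y) ∧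
      (stepQ cs κ x y ≠ x → labQ cs κ (stepQ cs κ x y) y <
        labQ cs κ (stepQ cs κ x (stepQ cs κ x y)) (stepQ cs κ x y)) := by
  rcases eq_none_or_trip y with rfl | ⟨a, v, u, rfl⟩
  · exact absurd (hle_none hxy) hne
  rcases eq_none_or_trip x with rfl | ⟨a', v', u', rfl⟩
  · by_cases h : u = demazure cs a v
    · by_cases h' : a = v * u⁻¹
      · rw [stepQ_none_bot κ h h']
        refine ⟨hcov_of_rankQ trivial hy trivial ?_, trivial, fun h => absurd rfl h⟩
        have h1 := length_eq_of_eq_demazure h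
        rw [← h'] at h1
        rw [rankQ_trip]
        simp [rankQ, h1]
      · have hle := le_of_eq_demazure h
        obtain ⟨h1, h2, h3⟩ := (hκ.down u).incPath_eq_cons hle h'
        have h4 := (hκ.down u).firstLabel_lt hle h'
        rw [next_none_left hκ h h', stepQ_none_left κ h h']
        have hv := hvalid_of_mul_inv_le h2
        refine ⟨hcov_down_left hv h1, trivial, fun _ => ?_⟩
        have h5 := eq_demazure_of_le h (chainLE_of_downOk h1) hv
        by_cases h6 : a * firstLabel (downOk cs) (κ u) (v * u⁻¹) a = v * u⁻¹
        · rw [next_none_bot h5 h6, leftLab_lt_botLab]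
          exact (eq_demazure_iff hκ hle (length_eq_of_eq_demazure h)).mp h _
            (firstLabel_mem_incPath hκ hle h')
        · rw [next_none_left hκ h5 h6, leftLab_lt_leftLab (hκ u).1 (hκ u).2.2 h1.1
            ((hκ.down u).incPath_eq_cons h2 h6).1.1]
          exact h4 h6
    · have hle := hvalid_trip.mp hy
      obtain ⟨h1, h2, _⟩ := (hκ.down 1).incPath_eq_cons hle h
      have h4 := (hκ.down 1).firstLabel_lt hle h
      rw [next_none_right hκ hy h, stepQ_none_right κ h]
      have hv := hvalid_trip.mpr h2
      refine ⟨hcov_down_right hv h1, trivial, fun _ => ?_⟩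
      by_cases h5 : u * firstLabel (downOk cs) (κ 1) (demazure cs a v) u = demazure cs a v
      · exact rightLab_lt_next hκ _ h5
      · rw [next_none_right hκ hv h5, rightLab_lt_rightLab]
        exact h4 h5
  · obtain ⟨l1, l2, l3⟩ := hle_trip.mp hxy
    by_cases h : u = u'
    · subst h
      by_cases h' : a = a'
      · subst h'
        have h'' : v ≠ v' := fun e => hne (by rw [e])
        obtain ⟨h1, h2, _⟩ := (hκ.up 1).incPath_eq_cons l2 h''
        have h4 := (hκ.up 1).firstLabel_lt l2 h''
        rw [next_mid, stepQ_mid]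
        have hle := hle_trip.mpr ⟨.refl a, h2, .refl u⟩
        refine ⟨hcov_up (hvalid_of_hle hx hle) h1, hle, fun h5 => ?_⟩
        rw [next_mid, midLab_lt_midLab]
        exact h4 fun e => h5 (by rw [e])
      · obtain ⟨h1, h2, _⟩ := (hκ.down u).incPath_eq_cons l1 h'
        have h4 := (hκ.down u).firstLabel_lt l1 h'
        rw [next_left hκ h' l1, stepQ_left κ h']
        have hle := hle_trip.mpr ⟨h2, l2, .refl u⟩
        refine ⟨hcov_down_left (hvalid_of_hle hx hle) h1, hle, fun _ => ?_⟩
        by_cases h5 : a * firstLabel (downOk cs) (κ u) a' a = a'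
        · rw [h5, next_mid]
          exact leftLab_lt_midLab κ _ _ _
        · rw [next_left hκ h5 h2, leftLab_lt_leftLab (hκ u).1 (hκ u).2.2 h1.1
            ((hκ.down u).incPath_eq_cons h2 h5).1.1]
          exact h4 h5
    · obtain ⟨h1, h2, _⟩ := (hκ.down 1).incPath_eq_cons l3 h
      have h4 := (hκ.down 1).firstLabel_lt l3 h
      rw [next_right hκ h l3, stepQ_right κ h]
      have hle := hle_trip.mpr ⟨l1, l2, h2⟩
      refine ⟨hcov_down_right (hvalid_of_hle hx hle) h1, hle, fun _ => ?_⟩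
      by_cases h5 : u * firstLabel (downOk cs) (κ 1) u' u = u'
      · rw [h5]
        by_cases h6 : a = a'
        · rw [h6, next_mid]
          exact rightLab_lt_midLab κ _ _
        · rw [next_left hκ h6 l1]
          exact rightLab_lt_leftLab κ _ _ _
      · rw [next_right hκ h5 h2, rightLab_lt_rightLab]
        exact h4 h5

lemma not_chainLE_of_downOk {u t : W} (ht : downOk cs u t) : ¬ ChainLE cs u (u * t) := by
  intro h
  have := h.length_le
  have := ht.2
  omega

/-- Any other coatom has a larger label and starts no increasing chain. -/
lemma stepQ_other (hκ : AdaptedOrders cs κ) {x y z : Option (W × W × W)} (hx : hvalid cs x)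
    (hy : hvalid cs y) (hxy : hle cs x y) (hne : x ≠ y) (hz : hcov cs z y)
    (hxz : hle cs x z) (hzm : z ≠ stepQ cs κ x y) :
    labQ cs κ (stepQ cs κ x y) y < labQ cs κ z y ∧
      (z ≠ x → ¬ labQ cs κ z y < labQ cs κ (stepQ cs κ x z) z) := by
  rcases eq_none_or_trip y with rfl | ⟨a, v, u, rfl⟩
  · exact absurd (hle_none hxy) hne
  have hzn : z ≠ none := by
    rintro rfl
    have hx0 := hle_none hxz
    subst hx0
    obtain ⟨h1, _, _⟩ := stepQ_spec hκ hx hy hxy hne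
    exact hzm (eq_of_hcov hz h1.1 trivial h1.2.2.1).symm
  rcases eq_none_or_trip x with rfl | ⟨a', v', u', rfl⟩
  · by_cases h : u = demazure cs a v
    · have hle := le_of_eq_demazure h
      rcases hcov_trip hzn hz with ⟨t, ht, rfl⟩ | ⟨t, ht, rfl⟩ | ⟨t, ht, rfl⟩
      · have := hvalid_trip.mp hz.1
        rw [← h] at this
        exact absurd this (not_chainLE_of_downOk ht)
      · have h5 := eq_demazure_of_le h (chainLE_of_downOk ht) hz.1
        have h6 := le_of_eq_demazure h5
        have h' : a ≠ v * u⁻¹ := by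
          rintro e
          rw [← e] at h6
          exact not_chainLE_of_downOk ht h6
        obtain ⟨h1, _, _⟩ := (hκ.down u).incPath_eq_cons hle h'
        rw [next_none_left hκ h h', labQ_left κ ht.1]
        have hts : t ≠ firstLabel (downOk cs) (κ u) (v * u⁻¹) a := by
          rintro e
          rw [stepQ_none_left κ h h', ← e] at hzm
          exact hzm rfl
        rw [leftLab_lt_leftLab (hκ u).1 (hκ u).2.2 h1.1 ht.1]
        refine ⟨(hκ.down u).firstLabel_min ht h6 hts, fun _ hlt => ?_⟩
        refine hts ((hκ.down u).eq_firstLabel ht h6 fun h7 => ?_)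
        rwa [next_none_left hκ h5 h7, leftLab_lt_leftLab (hκ u).1 (hκ u).2.2 ht.1
          ((hκ.down u).incPath_eq_cons h6 h7).1.1] at hlt
      · rw [labQ_mid]
        exact ⟨next_none_lt_midLab hκ hy t, fun _ => (next_none_lt_midLab hκ hz.1 t).not_gt⟩
    · rcases hcov_trip hzn hz with ⟨t, ht, rfl⟩ | ⟨t, ht, rfl⟩ | ⟨t, ht, rfl⟩
      · rw [next_none_right hκ hy h, labQ_right κ ht.1, rightLab_lt_rightLab]
        have h6 := hvalid_trip.mp hz.1
        have hts : t ≠ firstLabel (downOk cs) (κ 1) (demazure cs a v) u := by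
          rintro e
          rw [stepQ_none_right κ h, ← e] at hzm
          exact hzm rfl
        refine ⟨(hκ.down 1).firstLabel_min ht h6 hts, fun _ hlt => ?_⟩
        refine hts ((hκ.down 1).eq_firstLabel ht h6 fun h7 => ?_)
        rwa [next_none_right hκ hz.1 h7, rightLab_lt_rightLab] at hlt
      · rw [labQ_left κ ht.1]
        refine ⟨?_, fun _ => ?_⟩
        · rw [next_none_right hκ hy h]
          exact rightLab_lt_leftLab κ _ _ _
        · by_cases h' : u = demazure cs (a * t) v
          · exact not_leftLab_lt_next hκ ht h h'
          · rw [next_none_right hκ hz.1 h']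
            exact (rightLab_lt_leftLab κ _ _ _).not_gt
      · rw [labQ_mid]
        exact ⟨next_none_lt_midLab hκ hy t, fun _ => (next_none_lt_midLab hκ hz.1 t).not_gt⟩
  · obtain ⟨l1, l2, l3⟩ := hle_trip.mp hxy
    by_cases h : u = u'
    · subst h
      by_cases h' : a = a'
      · subst h'
        rcases hcov_trip hzn hz with ⟨t, ht, rfl⟩ | ⟨t, ht, rfl⟩ | ⟨t, ht, rfl⟩
        · exact absurd (hle_trip.mp hxz).2.2 (not_chainLE_of_downOk ht)
        · exact absurd (hle_trip.mp hxz).1 (not_chainLE_of_downOk ht)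
        · rw [next_mid, labQ_mid, midLab_lt_midLab]
          have h6 := (hle_trip.mp hxz).2.1
          have hts : t ≠ firstLabel (upOk cs) (κ 1) v' v := by
            rintro e
            rw [stepQ_mid, ← e] at hzm
            exact hzm rfl
          refine ⟨(hκ.up 1).firstLabel_min ht h6 hts, fun _ hlt => ?_⟩
          rw [next_mid, midLab_lt_midLab] at hlt
          exact hts ((hκ.up 1).eq_firstLabel ht h6 fun _ => hlt)
      · rw [next_left hκ h' l1]
        rcases hcov_trip hzn hz with ⟨t, ht, rfl⟩ | ⟨t, ht, rfl⟩ | ⟨t, ht, rfl⟩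
        · exact absurd (hle_trip.mp hxz).2.2 (not_chainLE_of_downOk ht)
        · have h6 := (hle_trip.mp hxz).1
          have hts : t ≠ firstLabel (downOk cs) (κ u) a' a := by
            rintro e
            rw [stepQ_left κ h', ← e] at hzm
            exact hzm rfl
          rw [labQ_left κ ht.1, leftLab_lt_leftLab (hκ u).1 (hκ u).2.2
            ((hκ.down u).incPath_eq_cons l1 h').1.1 ht.1]
          refine ⟨(hκ.down u).firstLabel_min ht h6 hts, fun _ hlt => ?_⟩
          refine hts ((hκ.down u).eq_firstLabel ht h6 fun h7 => ?_)
          rwa [next_left hκ h7 h6, leftLab_lt_leftLab (hκ u).1 (hκ u).2.2 ht.1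
            ((hκ.down u).incPath_eq_cons h6 h7).1.1] at hlt
        · rw [labQ_mid, next_left hκ h' l1]
          exact ⟨leftLab_lt_midLab κ _ _ _, fun _ => (leftLab_lt_midLab κ _ _ _).not_gt⟩
    · rw [next_right hκ h l3]
      rcases hcov_trip hzn hz with ⟨t, ht, rfl⟩ | ⟨t, ht, rfl⟩ | ⟨t, ht, rfl⟩
      · have h6 := (hle_trip.mp hxz).2.2
        have hts : t ≠ firstLabel (downOk cs) (κ 1) u' u := by
          rintro e
          rw [stepQ_right κ h, ← e] at hzm
          exact hzm rfl
        rw [labQ_right κ ht.1, rightLab_lt_rightLab]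
        refine ⟨(hκ.down 1).firstLabel_min ht h6 hts, fun _ hlt => ?_⟩
        refine hts ((hκ.down 1).eq_firstLabel ht h6 fun h7 => ?_)
        rwa [next_right hκ h7 h6, rightLab_lt_rightLab] at hlt
      · rw [labQ_left κ ht.1, next_right hκ h l3]
        exact ⟨rightLab_lt_leftLab κ _ _ _, fun _ => (rightLab_lt_leftLab κ _ _ _).not_gt⟩
      · rw [labQ_mid, next_right hκ h l3]
        exact ⟨rightLab_lt_midLab κ _ _, fun _ => (rightLab_lt_midLab κ _ _).not_gt⟩

end Labels

variable (cs)

/-- For every `q ∈ Q̂`, the interval `[0̂, q]` admits an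
EL-labeling: there exist a totally ordered set `Λ` and an edge labeling of
`[0̂, q]` with values in `Λ` such that every interval of `[0̂, q]` contains a
unique increasing maximal chain, and this chain is lexicographically minimal
among all maximal chains of that interval. -/
theorem interval_EL_exists (q : Option (W × W × W)) (hq : hvalid cs q) :
    ∃ (Λ : Type) (lt : Λ → Λ → Prop), IsStrictTotalOrder Λ lt ∧
      ∃ lab : Option (W × W × W) → Option (W × W × W) → Λ,
        IsELOn
          (fun p₁ p₂ => (hvalid cs p₁ ∧ hle cs p₁ q) ∧ (hvalid cs p₂ ∧ hle cs p₂ q) ∧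
            hle cs p₁ p₂)
          (hcov cs) lt lab := by
  obtain ⟨K, _, κ, hκ⟩ := exists_reflOrders cs
  have hκ : AdaptedOrders cs κ := hκ
  refine ⟨ℕ ×ₗ K, (· < ·), inferInstance, labQ cs κ, ?_⟩
  have cov_le : ∀ {y z}, hle cs y q → hcov cs z y → hvalid cs z ∧ hle cs z q ∧ hle cs z y :=
    fun hy h => ⟨h.1, hle_trans h.2.2.1.1 hy, h.2.2.1.1⟩
  apply isELOn_of_firstStep (rankQ cs) (stepQ cs κ)
  · exact fun h h' => ⟨h.1, h'.2.1, hle_trans h.2.2 h'.2.2⟩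
  · exact fun h => ⟨⟨h.1, h.1, hle_refl _⟩, ⟨h.2.1, h.2.1, hle_refl _⟩⟩
  · rintro x y ⟨hx, hy, h⟩
    by_cases hne : x = y
    · rw [hne]
    · exact (rankQ_lt hx.1 hy.1 ⟨h, hne⟩).le
  · rintro y z ⟨hy, _, _⟩ hz
    obtain ⟨h1, h2, h3⟩ := cov_le hy.2 hz
    exact ⟨⟨⟨h1, h2⟩, hy, h3⟩, rankQ_lt h1 hy.1 hz.2.2.1⟩
  · rintro x y z _ hxy hzy ⟨_, hz, h⟩
    exact eq_of_hcov hxy hz.1 h hzy.2.2.1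
  · rintro x y ⟨hx, hy, h⟩ hne
    obtain ⟨h1, h2, h3⟩ := stepQ_spec hκ hx.1 hy.1 h hne
    obtain ⟨h4, h5, _⟩ := cov_le hy.2 h1
    exact ⟨h1, ⟨hx, ⟨h4, h5⟩, h2⟩, h3⟩
  · rintro x y z ⟨hx, hy, h⟩ hne hz ⟨_, _, hxz⟩ hzm
    exact stepQ_other hκ hx.1 hy.1 h hne hz hxz hzm

end TwistedTP
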